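/- For a maximal ideal λ of R and n ∈ ℤ, let C_{λ,n} be the full subcategory of Artinian graded A-modules whose simple subquotients are among the simple subquotients of A^λ[n]. Then: (1) C_{λ,n} = C_{μ,m} if and only if μ = σ^{m−n}(λ); (2) every Artinian graded A-module M decomposes as a direct sum ⊕ M_{λ,n} with M_{λ,n} ∈ C_{λ,n}; and (3) if λ ∉ Z^σ and λ is a regular point of Spec R, then C_{λ,n} has finite homological dimension, bounded by the Krull dimension of the local ring R_λ. -/

import Mathlib

noncomputable section

/-- A realization of the generalized Weyl algebra `T(R,σ,v)`:
a `ℤ`-graded `ℂ`-algebra `A` containing `R` in degree `0`, with elements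
`t₊` of degree `1` and `t₋` of degree `-1` satisfying the GWA relations, such that each
homogeneous component `A_n` is free of rank one as a left `R`-module with basis
`t₊^n` (for `n ≥ 0`) resp. `t₋^{-n}` (for `n ≤ 0`). -/
structure GWA (R : Type) [CommRing R] [Algebra ℂ R] (σ : R ≃ₐ[ℂ] R) (v : R) : Type 1 where
  A : Type
  [ringA : Ring A]
  [algA : Algebra ℂ A]
  emb : R →ₐ[ℂ] A
  tp : A
  tm : A
  rel1 : ∀ r : R, emb r * tp = tp * emb (σ r)
  rel2 : ∀ r : R, emb (σ r) * tm = tm * emb r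
  rel3 : tm * tp = emb (σ v)
  rel4 : tp * tm = emb v
  deg : ℤ → AddSubgroup A
  algmap_mem : ∀ c : ℂ, algebraMap ℂ A c ∈ deg 0
  emb_mem : ∀ r : R, emb r ∈ deg 0
  tp_mem : tp ∈ deg 1
  tm_mem : tm ∈ deg (-1)
  mul_mem : ∀ {i j : ℤ} {a b : A}, a ∈ deg i → b ∈ deg j → a * b ∈ deg (i + j)
  decomp : ∀ a : A, ∃ (s : Finset ℤ) (g : ℤ → A), (∀ i, g i ∈ deg i) ∧ a = ∑ i ∈ s, g i
  indep : ∀ (s : Finset ℤ) (g : ℤ → A), (∀ i, g i ∈ deg i) → (∑ i ∈ s, g i) = 0 →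
    ∀ i ∈ s, g i = 0
  free_pos : ∀ n : ℕ, ∀ a ∈ deg (n : ℤ), ∃! r : R, a = emb r * tp ^ n
  free_neg : ∀ n : ℕ, ∀ a ∈ deg (-(n : ℤ)), ∃! r : R, a = emb r * tm ^ n

attribute [instance] GWA.ringA GWA.algA

variable {R : Type} [CommRing R] [Algebra ℂ R] {σ : R ≃ₐ[ℂ] R} {v : R}

/-- A `ℤ`-graded left module over (a realization of) a generalized Weyl algebra. -/
structure GradedMod (G : GWA R σ v) : Type 1 where
  M : Type
  [acg : AddCommGroup M]
  [mod : Module G.A M]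
  deg : ℤ → AddSubgroup M
  smul_mem : ∀ {i j : ℤ} {a : G.A} {m : M}, a ∈ G.deg i → m ∈ deg j → a • m ∈ deg (i + j)
  decomp : ∀ m : M, ∃ (s : Finset ℤ) (g : ℤ → M), (∀ i, g i ∈ deg i) ∧ m = ∑ i ∈ s, g i
  indep : ∀ (s : Finset ℤ) (g : ℤ → M), (∀ i, g i ∈ deg i) → (∑ i ∈ s, g i) = 0 →
    ∀ i ∈ s, g i = 0

attribute [instance] GradedMod.acg GradedMod.mod

variable {G : GWA R σ v}

/-- A homomorphism of graded modules that shifts degrees by `n`, i.e. an element of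
`Hom_gr(X, Y[n])`. -/
structure GHom (X Y : GradedMod G) (n : ℤ) : Type where
  toLin : X.M →ₗ[G.A] Y.M
  map_deg : ∀ i : ℤ, ∀ m ∈ X.deg i, toLin m ∈ Y.deg (i + n)

/-- `X` is isomorphic to `Y[n]` as a graded module. -/
def GIso (X Y : GradedMod G) (n : ℤ) : Prop :=
  ∃ f : GHom X Y n, Function.Bijective f.toLin

/-- A submodule is graded if every element of it is a sum of homogeneous elements of it. -/
def IsGradedSub (X : GradedMod G) (N : Submodule G.A X.M) : Prop :=
  ∀ m ∈ N, ∃ (s : Finset ℤ) (g : ℤ → X.M),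
    (∀ i, g i ∈ X.deg i) ∧ (∀ i, g i ∈ N) ∧ m = ∑ i ∈ s, g i

/-- `χ_λ = {k ∈ ℤ : σ^k(v) ∈ λ}`. -/
def chiSet (σ : R ≃ₐ[ℂ] R) (v : R) (lam : Ideal R) : Set ℤ := {k : ℤ | (σ ^ k) v ∈ lam}

/-- `X` is (a realization of) the graded module `A^λ = A/Aλ`: it is cyclic, generated by a
degree-zero element whose annihilator is the left ideal generated by `λ`. -/
def IsStdMod (G : GWA R σ v) (lam : Ideal R) (X : GradedMod G) : Prop :=
  ∃ x ∈ X.deg 0, Submodule.span G.A {x} = ⊤ ∧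
    ∀ a : G.A, a • x = 0 ↔ a ∈ Submodule.span G.A (G.emb '' (lam : Set R))

/-- A graded module is simple if it is nonzero and has no proper nontrivial graded submodules. -/
def IsSimpleGr (X : GradedMod G) : Prop :=
  (∃ m : X.M, m ≠ 0) ∧ ∀ N : Submodule G.A X.M, IsGradedSub X N → N = ⊥ ∨ N = ⊤

/-- Artinian graded module : the descending chain condition on graded submodules. -/
def IsArtinianGr (X : GradedMod G) : Prop :=
  ∀ f : ℕ → Submodule G.A X.M, (∀ n, IsGradedSub X (f n)) →
    (∀ n, f (n + 1) ≤ f n) → ∃ n, ∀ m, n ≤ m → f m = f n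

/-- `Y` is a graded subquotient of `X`. -/
def IsSubquotient (X Y : GradedMod G) : Prop :=
  ∃ (Q P : Submodule G.A X.M), IsGradedSub X Q ∧ IsGradedSub X P ∧ P ≤ Q ∧
    ∃ φ : Q →ₗ[G.A] Y.M, Function.Surjective φ ∧
      (∀ q : Q, φ q = 0 ↔ (q : X.M) ∈ P) ∧
      (∀ (i : ℤ) (q : Q), (q : X.M) ∈ X.deg i → φ q ∈ Y.deg i)

/-- `δ(M) = {i : M_i ≠ 0}`. -/
def deltaSet (X : GradedMod G) : Set ℤ := {i : ℤ | X.deg i ≠ ⊥}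

/-- An interval of `ℤ` (possibly unbounded): a convex subset. -/
def IsIntervalZ (s : Set ℤ) : Prop := ∀ a ∈ s, ∀ b ∈ s, ∀ c : ℤ, a ≤ c → c ≤ b → c ∈ s

/-- A graded extension `0 → T → E → S → 0` (all maps degree-preserving). -/
structure GExt1 (S T : GradedMod G) : Type 1 where
  E : GradedMod G
  f : GHom T E 0
  g : GHom E S 0
  inj : Function.Injective f.toLin
  exact : Function.Exact f.toLin g.toLin
  surj : Function.Surjective g.toLin

/-- A graded extension splits if the surjection admits a graded section. -/
def GExt1.Split {S T : GradedMod G} (e : GExt1 S T) : Prop :=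
  ∃ s : GHom S e.E 0, e.g.toLin ∘ₗ s.toLin = LinearMap.id
/-- Baer equivalence (one-step morphism) of graded extensions. -/
def GExt1Rel {S T : GradedMod G} (e e' : GExt1 S T) : Prop :=
  ∃ φ : e.E.M →ₗ[G.A] e'.E.M,
    (∀ i : ℤ, ∀ m ∈ e.E.deg i, φ m ∈ e'.E.deg i) ∧
    φ ∘ₗ e.f.toLin = e'.f.toLin ∧ e'.g.toLin ∘ₗ φ = e.g.toLin

/-- `Ext¹_gr(S,T)` as the set of equivalence classes of graded extensions of `S` by `T`. -/
def Ext1ClassGr (S T : GradedMod G) : Type 1 := Quot (GExt1Rel (S := S) (T := T))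

/-- An `(n+2)`-fold graded extension `0 → T → E 0 → ⋯ → E (n+1) → S → 0`
(the entries `E i` for `i > n+1` are irrelevant). -/
structure GExtChain (n : ℕ) (S T : GradedMod G) : Type 1 where
  E : ℕ → GradedMod G
  f : GHom T (E 0) 0
  d : ∀ i : ℕ, GHom (E i) (E (i + 1)) 0
  g : GHom (E (n + 1)) S 0
  inj : Function.Injective f.toLin
  ex0 : Function.Exact f.toLin (d 0).toLin
  exmid : ∀ i < n, Function.Exact (d i).toLin (d (i + 1)).toLin
  exlast : Function.Exact (d n).toLin g.toLin
  surj : Function.Surjective g.toLin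

/-- Morphism-induced (Yoneda) relation on `(n+2)`-fold graded extensions. -/
def GChainRel {n : ℕ} {S T : GradedMod G} (e e' : GExtChain n S T) : Prop :=
  ∃ φ : ∀ i : ℕ, (e.E i).M →ₗ[G.A] (e'.E i).M,
    (∀ i : ℕ, ∀ j : ℤ, ∀ m ∈ (e.E i).deg j, φ i m ∈ (e'.E i).deg j) ∧
    φ 0 ∘ₗ e.f.toLin = e'.f.toLin ∧
    (∀ i ≤ n, (e'.d i).toLin ∘ₗ φ i = φ (i + 1) ∘ₗ (e.d i).toLin) ∧
    e'.g.toLin ∘ₗ φ (n + 1) = e.g.toLin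

/-- `Ext^{n+2}_gr(S,T)` as the set of Yoneda-equivalence classes of `(n+2)`-fold graded
extensions of `S` by `T`. -/
def ExtClassGr (n : ℕ) (S T : GradedMod G) : Type 1 :=
  Quot (GChainRel (n := n) (S := S) (T := T))
/-- A graded submodule, regarded as a graded module in its own right. -/
def SubGM (X : GradedMod G) (N : Submodule G.A X.M) (hN : IsGradedSub X N) : GradedMod G where
  M := ↥N
  deg i :=
    { carrier := {m : ↥N | (m : X.M) ∈ X.deg i}
      add_mem' := fun {a b} ha hb => by
        simp only [Set.mem_setOf_eq, Submodule.coe_add] at *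
        exact add_mem ha hb
      zero_mem' := by simp only [Set.mem_setOf_eq, Submodule.coe_zero]; exact zero_mem _
      neg_mem' := fun {a} ha => by
        simp only [Set.mem_setOf_eq, Submodule.coe_neg] at *
        exact neg_mem ha }
  smul_mem := by
    intro i j a m ha hm
    simp only [AddSubgroup.mem_mk, Set.mem_setOf_eq, Submodule.coe_smul] at *
    exact X.smul_mem ha hm
  decomp := by
    intro m
    obtain ⟨s, g, hgdeg, hgN, hsum⟩ := hN (m : X.M) m.2
    refine ⟨s, fun i => ⟨g i, hgN i⟩, fun i => hgdeg i, ?_⟩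
    apply Subtype.ext
    rw [Submodule.coe_sum]
    exact hsum
  indep := by
    intro s g hg h0 i hi
    have h0' : (∑ j ∈ s, ((g j : X.M))) = 0 := by
      rw [← Submodule.coe_sum, h0, Submodule.coe_zero]
    have := X.indep s (fun j => (g j : X.M)) (fun j => hg j) h0' i hi
    exact Subtype.ext this
/-- Membership in the category `C_{λ,n}`: Artinian graded modules all of whose simple graded
subquotients are (isomorphic to) simple graded subquotients of `A^λ[n]`. -/
def InCat (G : GWA R σ v) (lam : Ideal R) (n : ℤ) (M : GradedMod G) : Prop :=
  IsArtinianGr M ∧ ∀ S : GradedMod G, IsSubquotient M S → IsSimpleGr S →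
    ∃ X : GradedMod G, IsStdMod G lam X ∧
      ∃ S' : GradedMod G, IsSubquotient X S' ∧ IsSimpleGr S' ∧ GIso S S' n

/-- The Yoneda class of an `(n+2)`-fold graded extension is zero iff the extension is
congruent to one whose front monomorphism splits. -/
def GChainZero {n : ℕ} {S T : GradedMod G} (e : GExtChain n S T) : Prop :=
  ∃ e' : GExtChain n S T,
    (Quot.mk (GChainRel (n := n) (S := S) (T := T)) e'
       = Quot.mk (GChainRel (n := n) (S := S) (T := T)) e) ∧
    ∃ r : GHom (e'.E 0) T 0, r.toLin ∘ₗ e'.f.toLin = LinearMap.id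


section RegLocal
open IsLocalRing

theorem gwa_cancel {a b : WithBot ℕ∞} (h : a + 1 ≤ b + 1) : a ≤ b := by
  rcases a with _ | _ | a
  · exact bot_le
  · rcases b with _ | _ | b
    · exact absurd h (by decide)
    · exact le_rfl
    · exact absurd h (by
        rw [not_le]; 
        exact WithBot.coe_lt_coe.2 (WithTop.coe_lt_top _))
  · rcases b with _ | _ | b
    · exfalso
      change (((a : ℕ) : ℕ∞) + 1 : WithBot ℕ∞) ≤ ⊥ at h
      rw [le_bot_iff] at h
      exact absurd h (by exact WithBot.coe_ne_bot)
    · exact WithBot.coe_le_coe.2 le_top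
    · change (((a : ℕ) : WithBot ℕ∞) + 1) ≤ ((b : ℕ) : WithBot ℕ∞) + 1 at h
      change (((a : ℕ) : WithBot ℕ∞)) ≤ ((b : ℕ) : WithBot ℕ∞)
      norm_cast at h ⊢
      omega

theorem gwa_mem_exchange {B : Type*} [CommRing B] [IsLocalRing B] (s : Finset B)
    (hs : Ideal.span (s : Set B) = maximalIdeal B) (x : B) (hx : x ∈ maximalIdeal B)
    (hx2 : x ∉ maximalIdeal B ^ 2) : ∃ y ∈ s, ∀ z ∈ s,
      z ∈ Ideal.span {x} ⊔ Ideal.span ((s : Set B) \ {y}) := by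
  classical
  rw [← hs] at hx
  obtain ⟨a, ha⟩ := Submodule.mem_span_finset'.1 hx
  have : ∃ y : s, IsUnit (a y) := by
    by_contra! hcon
    apply hx2
    rw [← ha, pow_two]
    refine Ideal.sum_mem _ fun i _ => ?_
    refine Ideal.mul_mem_mul ((mem_maximalIdeal _).2 (hcon i)) ?_
    rw [← hs]; exact Ideal.subset_span i.2
  obtain ⟨y, u, hu⟩ := this
  refine ⟨y, y.2, fun z hz => ?_⟩
  by_cases hzy : z = y
  · subst hzy
    have h1 : a y • (y : B) = x - ∑ i ∈ Finset.univ.erase y, a i • (i : B) := by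
      rw [← ha, ← Finset.add_sum_erase _ _ (Finset.mem_univ y)]; ring
    have h2 : (y : B) = ((u⁻¹ : Bˣ) : B) * (x - ∑ i ∈ Finset.univ.erase y, a i • (i : B)) := by
      rw [← h1, ← hu, smul_eq_mul, Units.inv_mul_cancel_left]
    suffices h4 : ((u⁻¹ : Bˣ) : B) * (x - ∑ i ∈ Finset.univ.erase y, a i • (i : B)) ∈
        Ideal.span {x} ⊔ Ideal.span ((s : Set B) \ {(y : B)}) by
      rwa [← h2] at h4
    refine Ideal.mul_mem_left _ _ (Ideal.sub_mem _ ?_ ?_)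
    · exact Ideal.mem_sup_left (Ideal.mem_span_singleton_self x)
    · refine Ideal.mem_sup_right (Ideal.sum_mem _ fun i hi => ?_)
      refine Ideal.mul_mem_left _ _ (Ideal.subset_span ⟨i.2, ?_⟩)
      intro h
      exact (Finset.mem_erase.1 hi).1 (Subtype.ext h)
  · exact Ideal.mem_sup_right (Ideal.subset_span ⟨hz, hzy⟩)

theorem gwa_reg_dom : ∀ (n : ℕ) (B : Type) [CommRing B] [IsLocalRing B] [IsNoetherianRing B]
    (s : Finset B), s.card ≤ n → Ideal.span (s : Set B) = maximalIdeal B →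
    (n : WithBot ℕ∞) ≤ ringKrullDim B → IsDomain B := by
  intro n
  induction n with
  | zero =>
    intro B _ _ _ s hs hsp _
    have : s = ∅ := by simpa using hs
    subst this
    have h : maximalIdeal B = ⊥ := by rw [← hsp]; simp
    have := (isField_iff_maximalIdeal_eq (R := B)).2 h
    exact this.isDomain
  | succ n ih =>
    intro B _ _ _ s hs hsp hdim
    classical
    have hnf : ¬ (ringKrullDim B ≤ 0) := by
      intro h
      have := hdim.trans h
      norm_cast at this
    have hne : maximalIdeal B ≠ ⊥ := by
      intro h
      exact hnf (ringKrullDim_eq_zero_of_isField ((isField_iff_maximalIdeal_eq (R := B)).2 h)).le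
    have hm2 : ¬ maximalIdeal B ≤ maximalIdeal B ^ 2 := by
      intro h
      apply hne
      refine Submodule.eq_bot_of_le_smul_of_le_jacobson_bot (maximalIdeal B) _
        (IsNoetherian.noetherian _) ?_ ?_
      · rwa [smul_eq_mul, ← pow_two]
      · rw [IsLocalRing.jacobson_eq_maximalIdeal _ bot_ne_top]
    have hmp : ∀ p ∈ minimalPrimes B, ¬ maximalIdeal B ≤ p := by
      intro p hp h
      have hpp : p.IsPrime := hp.1.1
      have : p = maximalIdeal B := le_antisymm (le_maximalIdeal hpp.ne_top) h
      apply hnf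
      rw [← IsLocalRing.maximalIdeal_height_eq_ringKrullDim, ← this,
        (Ideal.height_eq_zero_iff).2 hp]
      rfl
    have hfin := minimalPrimes.finite_of_isNoetherianRing B
    obtain ⟨x, hxm, hx2, hxp⟩ : ∃ x ∈ maximalIdeal B, x ∉ maximalIdeal B ^ 2 ∧
        ∀ p ∈ minimalPrimes B, x ∉ p := by
      have := mt (Ideal.subset_union_prime (s := insert (maximalIdeal B ^ 2) hfin.toFinset)
        (f := id) (maximalIdeal B ^ 2) (maximalIdeal B ^ 2) (I := maximalIdeal B) (by
          intro i hi h1 _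
          rcases Finset.mem_insert.1 hi with h | h
          · exact absurd h h1
          · exact ((hfin.mem_toFinset).1 h).1.1)).1 (by
          rintro ⟨i, hi, hle⟩
          rcases Finset.mem_insert.1 hi with h | h
          · subst h; exact hm2 hle
          · exact hmp i ((hfin.mem_toFinset).1 h) hle)
      obtain ⟨x, hx, hx'⟩ := Set.not_subset.1 this
      simp only [Finset.coe_insert, Set.Finite.coe_toFinset, id, Set.mem_iUnion, not_exists,
        Set.mem_insert_iff] at hx'
      exact ⟨x, hx, hx' _ (Or.inl rfl), fun p hp => hx' p (Or.inr hp)⟩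
    obtain ⟨y, hys, hyz⟩ := gwa_mem_exchange s hsp x hxm hx2
    have hxtop : Ideal.span {x} ≠ ⊤ := by
      intro h
      rw [Ideal.span_singleton_eq_top] at h
      exact (mem_maximalIdeal _).1 hxm h
    have : Nontrivial (B ⧸ Ideal.span {x}) := Ideal.Quotient.nontrivial_iff.2 hxtop
    have : IsLocalRing (B ⧸ Ideal.span {x}) :=
      IsLocalRing.of_surjective' (Ideal.Quotient.mk _) Ideal.Quotient.mk_surjective
    have hmx : Ideal.map (Ideal.Quotient.mk (Ideal.span {x})) (maximalIdeal B)
        = maximalIdeal (B ⧸ Ideal.span {x}) :=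
      IsLocalRing.map_maximalIdeal_of_surjective _ Ideal.Quotient.mk_surjective
    have hdom : IsDomain (B ⧸ Ideal.span {x}) := by
      refine ih (B ⧸ Ideal.span {x}) ((s.erase y).image (Ideal.Quotient.mk _)) ?_ ?_ ?_
      · refine Finset.card_image_le.trans ?_
        rw [Finset.card_erase_of_mem hys]; omega
      · rw [← hmx, Finset.coe_image, ← Ideal.map_span]
        apply le_antisymm
        · refine Ideal.map_mono ?_
          rw [← hsp]
          exact Ideal.span_mono (by simp)
        · rw [← hsp, Ideal.map_span, Ideal.span_le]
          rintro _ ⟨z, hz, rfl⟩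
          have h := Ideal.mem_map_of_mem (Ideal.Quotient.mk (Ideal.span {x})) (hyz z hz)
          rw [Ideal.map_sup, Ideal.map_quotient_self, bot_sup_eq] at h
          simpa using h
      · have h := ringKrullDim_le_ringKrullDim_quotient_add_card {x} (by
          rw [Finset.coe_singleton, Set.singleton_subset_iff]
          rw [SetLike.mem_coe, IsLocalRing.ringJacobson_eq_maximalIdeal]
          exact hxm)
        have h2 := hdim.trans h
        rw [Finset.coe_singleton, Finset.card_singleton] at h2
        push_cast at h2
        exact gwa_cancel h2
    have hpx : (Ideal.span {x}).IsPrime := (Ideal.Quotient.isDomain_iff_prime _).1 hdom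
    obtain ⟨p, hp, hpx'⟩ := Ideal.exists_minimalPrimes_le (I := ⊥) (J := Ideal.span {x}) bot_le
    have hpp : p.IsPrime := hp.1.1
    have hxnp : x ∉ p := hxp p hp
    have hpb : p = ⊥ := by
      refine Submodule.eq_bot_of_le_smul_of_le_jacobson_bot (maximalIdeal B) _
        (IsNoetherian.noetherian _) ?_ ?_
      · intro z hz
        obtain ⟨c, rfl⟩ := Ideal.mem_span_singleton'.1 (hpx' hz)
        have := (hpp.mem_or_mem hz).resolve_right hxnp
        rw [smul_eq_mul, mul_comm c]
        exact Ideal.mul_mem_mul hxm this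
      · rw [IsLocalRing.jacobson_eq_maximalIdeal _ bot_ne_top]
    subst hpb
    exact (IsDomain.of_bot_isPrime B)

/-- `l` is a regular sequence on `B/I`. -/
def GwaRegOn {B : Type} [CommRing B] : Ideal B → List B → Prop
  | _, [] => True
  | I, x :: l => (∀ b, b * x ∈ I → b ∈ I) ∧ GwaRegOn (I ⊔ Ideal.span {x}) l

theorem gwa_list_sup {B : Type} [CommRing B] (I : Ideal B) (x : B) (l : List B) :
    I ⊔ Ideal.ofList (x :: l) = (I ⊔ Ideal.span {x}) ⊔ Ideal.ofList l := by
  rw [Ideal.ofList_cons, sup_assoc]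

theorem gwa_reg_list {B : Type} [CommRing B] [IsLocalRing B] [IsNoetherianRing B] :
    ∀ (l : List B) (I : Ideal B), I ⊔ Ideal.ofList l = maximalIdeal B →
    (l.length : WithBot ℕ∞) ≤ ringKrullDim (B ⧸ I) → GwaRegOn I l := by
  classical
  have key : ∀ (l : List B) (I : Ideal B), I ⊔ Ideal.ofList l = maximalIdeal B → 
      ∃ s : Finset (B ⧸ I), ∃ (_ : IsLocalRing (B ⧸ I)), s.card ≤ l.length ∧ 
        Ideal.span (s : Set (B ⧸ I)) = maximalIdeal (B ⧸ I) := by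
    intro l I h
    have hI : I ≤ maximalIdeal B := h ▸ le_sup_left
    have : Nontrivial (B ⧸ I) := Ideal.Quotient.nontrivial_iff.2 
      (fun ht => by rw [ht, top_le_iff] at hI; exact Ideal.IsPrime.ne_top' hI)
    have : IsLocalRing (B ⧸ I) :=
      IsLocalRing.of_surjective' (Ideal.Quotient.mk _) Ideal.Quotient.mk_surjective
    refine ⟨l.toFinset.image (Ideal.Quotient.mk _), inferInstance, ?_, ?_⟩
    · exact Finset.card_image_le.trans (List.toFinset_card_le l)
    · rw [← IsLocalRing.map_maximalIdeal_of_surjective _ 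
        (Ideal.Quotient.mk_surjective (I := I)), ← h, Ideal.map_sup, Ideal.map_quotient_self, 
        bot_sup_eq, Ideal.ofList, Ideal.map_span]
      congr 1
      ext; simp
  intro l
  induction l with
  | nil => intro I _ _; trivial
  | cons x l ih =>
    intro I h hdim
    obtain ⟨s, hloc, hsc, hsp⟩ := key _ _ h
    have hdom := gwa_reg_dom _ _ s hsc hsp hdim
    have hIp : I.IsPrime := (Ideal.Quotient.isDomain_iff_prime _).1 hdom
    have hxI : x ∉ I := by
      intro hx
      have h' : I ⊔ Ideal.ofList l = maximalIdeal B := by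
        rw [← h, gwa_list_sup, sup_eq_left.2 ((Ideal.span_singleton_le_iff_mem _).2 hx)]
      obtain ⟨s, hloc, hsc, hsp⟩ := key _ _ h'
      have h1 := hdim.trans (ringKrullDim_le_spanFinrank_maximalIdeal (B ⧸ I))
      rw [← hsp] at h1
      have h2 := Submodule.spanFinrank_span_le_ncard_of_finite (R := B ⧸ I) s.finite_toSet
      rw [Set.ncard_coe_finset] at h2
      have h3 : (l.length + 1) ≤ s.card := by
        have : (x :: l).length ≤ Submodule.spanFinrank (Ideal.span (s : Set (B ⧸ I))) := by
          exact_mod_cast h1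
        exact this.trans h2
      omega
    refine ⟨fun b hb => (hIp.mem_or_mem hb).resolve_right hxI, ?_⟩
    refine ih _ (by rw [← h, gwa_list_sup]) ?_
    have hxm : x ∈ maximalIdeal B := by
      rw [← h, gwa_list_sup]
      exact Ideal.mem_sup_left (Ideal.mem_sup_right (Ideal.mem_span_singleton_self x))
    have hxm' : Ideal.Quotient.mk I x ∈ maximalIdeal (B ⧸ I) := by
      rw [← IsLocalRing.map_maximalIdeal_of_surjective _ 
        (Ideal.Quotient.mk_surjective (I := I))]
      exact Ideal.mem_map_of_mem _ hxm
    have h5 := ringKrullDim_le_ringKrullDim_quotient_add_card {Ideal.Quotient.mk I x} (by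
          rw [Finset.coe_singleton, Set.singleton_subset_iff]
          rw [SetLike.mem_coe, IsLocalRing.ringJacobson_eq_maximalIdeal]
          exact hxm')
    have h2 := hdim.trans h5
    rw [Finset.coe_singleton, Finset.card_singleton, List.length_cons] at h2
    push_cast at h2
    have h6 := gwa_cancel h2
    refine h6.trans (le_of_eq ?_)
    rw [← ringKrullDim_eq_of_ringEquiv (DoubleQuot.quotQuotEquivQuotSup I (Ideal.span {x})),
      Ideal.map_span, Set.image_singleton]

end RegLocal


section ExtVan
open CategoryTheory Abelian

variable {R : Type} [CommRing R]

/-- Vanishing of `Ext^j_R(X, W)`. -/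
def GwaEV (R : Type) [CommRing R] (X W : Type) [AddCommGroup X] [Module R X]
    [AddCommGroup W] [Module R W] (j : ℕ) : Prop :=
  Subsingleton (Ext.{0} (ModuleCat.of R X) (ModuleCat.of R W) j)

variable {X₁ X₂ X₃ W W' : Type} [AddCommGroup X₁] [Module R X₁] [AddCommGroup X₂] [Module R X₂]
  [AddCommGroup X₃] [Module R X₃] [AddCommGroup W] [Module R W] [AddCommGroup W'] [Module R W']

theorem gwa_sexact (f : X₁ →ₗ[R] X₂) (g : X₂ →ₗ[R] X₃) (hf : Function.Injective f)
    (hfg : Function.Exact f g) (hg : Function.Surjective g) :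
    (ModuleCat.shortComplexOfCompEqZero f g hfg.linearMap_comp_eq_zero).ShortExact where
  exact := (ShortComplex.ShortExact.moduleCat_exact_iff_function_exact _).mpr hfg
  mono_f := (ModuleCat.mono_iff_injective _).mpr hf
  epi_g := (ModuleCat.epi_iff_surjective _).mpr hg

theorem gwa_ev1 (f : X₁ →ₗ[R] X₂) (g : X₂ →ₗ[R] X₃) (hf : Function.Injective f)
    (hfg : Function.Exact f g) (hg : Function.Surjective g) {j : ℕ}
    (h1 : GwaEV R X₁ W j) (h2 : GwaEV R X₂ W (j + 1)) : GwaEV R X₃ W (j + 1) := by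
  unfold GwaEV at *
  refine subsingleton_of_forall_eq 0 fun x => ?_
  obtain ⟨y, hy⟩ := Ext.contravariant_sequence_exact₃ (gwa_sexact f g hf hfg hg)
    (ModuleCat.of R W) x (h2.elim _ _) (add_comm 1 j)
  rw [← hy, show y = 0 from h1.elim _ _, Ext.comp_zero]

theorem gwa_ev2 (f : X₁ →ₗ[R] X₂) (g : X₂ →ₗ[R] X₃) (hf : Function.Injective f)
    (hfg : Function.Exact f g) (hg : Function.Surjective g) {j : ℕ}
    (h1 : GwaEV R X₁ W j) (h2 : GwaEV R X₃ W j) : GwaEV R X₂ W j := by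
  unfold GwaEV at *
  refine subsingleton_of_forall_eq 0 fun x => ?_
  obtain ⟨y, hy⟩ := Ext.contravariant_sequence_exact₂ (gwa_sexact f g hf hfg hg)
    (ModuleCat.of R W) x (h1.elim _ _)
  rw [← hy, show y = 0 from h2.elim _ _, Ext.comp_zero]

theorem gwa_ev3 (f : X₁ →ₗ[R] X₂) (g : X₂ →ₗ[R] X₃) (hf : Function.Injective f)
    (hfg : Function.Exact f g) (hg : Function.Surjective g) {j : ℕ}
    (h1 : GwaEV R X₃ W (j + 1)) (h2 : GwaEV R X₂ W j) : GwaEV R X₁ W j := by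
  unfold GwaEV at *
  refine subsingleton_of_forall_eq 0 fun x => ?_
  obtain ⟨y, hy⟩ := Ext.contravariant_sequence_exact₁ (gwa_sexact f g hf hfg hg)
    (ModuleCat.of R W) x (add_comm 1 j) (h1.elim _ _)
  rw [← hy, show y = 0 from h2.elim _ _, Ext.comp_zero]

theorem gwa_ev4 [Module.Projective R X₁] (j : ℕ) : GwaEV R X₁ W (j + 1) := by
  unfold GwaEV
  have : Projective (ModuleCat.of R X₁) :=
    (ModuleCat.of R X₁).projective_of_categoryTheory_projective
  exact subsingleton_of_forall_eq 0 fun x => Ext.eq_zero_of_projective _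

theorem gwa_ev5 (f : X₁ →ₗ[R] X₂) (g : X₂ →ₗ[R] X₃) (hf : Function.Injective f)
    (hfg : Function.Exact f g) (hg : Function.Surjective g) {j : ℕ}
    (hI : Injective (ModuleCat.of R X₂)) :
    GwaEV R W X₁ (j + 2) ↔ GwaEV R W X₃ (j + 1) := by
  unfold GwaEV
  have hz : ∀ i, ∀ x : Ext.{0} (ModuleCat.of R W) (ModuleCat.of R X₂) (i+1), x = 0 :=
    fun i x => Ext.eq_zero_of_injective _
  constructor
  · intro h
    refine subsingleton_of_forall_eq 0 fun x => ?_
    obtain ⟨y, hy⟩ := Ext.covariant_sequence_exact₃ (ModuleCat.of R W) (gwa_sexact f g hf hfg hg)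
      x rfl (h.elim _ _)
    rw [← hy, show y = 0 from hz _ _, Ext.zero_comp]
  · intro h
    refine subsingleton_of_forall_eq 0 fun x => ?_
    obtain ⟨y, hy⟩ := Ext.covariant_sequence_exact₁ (ModuleCat.of R W) (gwa_sexact f g hf hfg hg)
      x (hz _ _) rfl
    rw [← hy, show y = 0 from h.elim _ _, Ext.zero_comp]

theorem gwa_ev5' (f : X₁ →ₗ[R] X₂) (g : X₂ →ₗ[R] X₃) (hf : Function.Injective f)
    (hfg : Function.Exact f g) (hg : Function.Surjective g)
    (hI : Injective (ModuleCat.of R X₂))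
    (h : ∀ φ : W →ₗ[R] X₃, ∃ ψ : W →ₗ[R] X₂, g ∘ₗ ψ = φ) : GwaEV R W X₁ 1 := by
  unfold GwaEV
  have hz : ∀ i, ∀ x : Ext.{0} (ModuleCat.of R W) (ModuleCat.of R X₂) (i+1), x = 0 :=
    fun i x => Ext.eq_zero_of_injective _
  refine subsingleton_of_forall_eq 0 fun x => ?_
  obtain ⟨y, hy⟩ := Ext.covariant_sequence_exact₁ (ModuleCat.of R W) (gwa_sexact f g hf hfg hg)
      x (hz _ _) rfl
  obtain ⟨y', rfl⟩ := Ext.homEquiv₀.symm.surjective y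
  obtain ⟨ψ, hψ⟩ := h y'.hom
  have : y' = ModuleCat.ofHom ψ ≫ ModuleCat.ofHom g := by
    rw [← ModuleCat.ofHom_comp, hψ]; rfl
  rw [← hy, this]
  change (Ext.mk₀ _).comp _ _ = 0
  have h2 := (gwa_sexact f g hf hfg hg).comp_extClass
  rw [← Ext.mk₀_comp_mk₀]
  erw [Ext.comp_assoc_of_second_deg_zero, h2]
  rw [Ext.comp_zero]

/-- Lifting when `Ext^1` vanishes. -/
theorem gwa_ev6 (f : X₁ →ₗ[R] X₂) (g : X₂ →ₗ[R] X₃) (hf : Function.Injective f)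
    (hfg : Function.Exact f g) (h : GwaEV R W X₁ 1) (φ : W →ₗ[R] X₃)
    (hφ : ∀ w, ∃ x, g x = φ w) : ∃ ψ : W →ₗ[R] X₂, g ∘ₗ ψ = φ := by
  have hg' : Function.Exact f g.rangeRestrict := by
    intro x
    rw [← hfg x]
    exact ⟨fun h => congrArg Subtype.val h, fun h => Subtype.ext h⟩
  have hs := gwa_sexact f g.rangeRestrict hf hg' g.surjective_rangeRestrict
  let φ' : W →ₗ[R] LinearMap.range g := φ.codRestrict _ hφ
  obtain ⟨y, hy⟩ := Ext.covariant_sequence_exact₃ (ModuleCat.of R W) hs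
    (Ext.mk₀ (ModuleCat.ofHom φ')) (zero_add 1) (h.elim _ _)
  obtain ⟨y', rfl⟩ := Ext.homEquiv₀.symm.surjective y
  change (Ext.mk₀ y').comp _ _ = _ at hy
  rw [Ext.mk₀_comp_mk₀] at hy
  have h2 := Ext.homEquiv₀.symm.injective hy
  refine ⟨y'.hom, ?_⟩
  ext w
  have h3 := congrArg (fun k => ((ModuleCat.Hom.hom k : W →ₗ[R] LinearMap.range g) w : X₃)) h2
  exact h3

/-- Extension of maps when `Ext^1` vanishes. -/
theorem gwa_ev7 (f : X₁ →ₗ[R] X₂) (g : X₂ →ₗ[R] X₃) (hf : Function.Injective f)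
    (hfg : Function.Exact f g) (hg : Function.Surjective g) (h : GwaEV R X₃ W 1)
    (φ : X₁ →ₗ[R] W) : ∃ ψ : X₂ →ₗ[R] W, ψ ∘ₗ f = φ := by
  obtain ⟨y, hy⟩ := Ext.contravariant_sequence_exact₁ (gwa_sexact f g hf hfg hg)
    (ModuleCat.of R W) (Ext.mk₀ (ModuleCat.ofHom φ)) (add_zero 1) (h.elim _ _)
  obtain ⟨y', rfl⟩ := Ext.homEquiv₀.symm.surjective y
  change (Ext.mk₀ _).comp (Ext.mk₀ y') _ = _ at hy
  rw [Ext.mk₀_comp_mk₀] at hy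
  have h2 := Ext.homEquiv₀.symm.injective hy
  refine ⟨y'.hom, ?_⟩
  have h3 := congrArg (fun k => (ModuleCat.Hom.hom k : X₁ →ₗ[R] W)) h2
  exact h3

theorem gwa_ev8 (s : R) (hs : ∀ x : X₁, s • x = 0)
    (hW : Function.Bijective (fun w : W => s • w)) (j : ℕ) : GwaEV R X₁ W j := by
  unfold GwaEV
  refine subsingleton_of_forall_eq 0 fun x => ?_
  let e : W ≃ₗ[R] W := LinearEquiv.ofBijective (LinearMap.lsmul R W s) hW
  have h1 : s • x = 0 := by
    have : s • x = (s • Ext.mk₀ (𝟙 (ModuleCat.of R X₁))).comp x (zero_add j) := by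
      rw [Ext.smul_comp, Ext.mk₀_id_comp]
    rw [this, ← Ext.mk₀_smul]
    have h0 : s • 𝟙 (ModuleCat.of R X₁) = 0 := by
      ext y
      exact hs y
    rw [h0, Ext.mk₀_zero, Ext.zero_comp]
  have h2 : x = (s • x).comp (Ext.mk₀ (ModuleCat.ofHom e.symm.toLinearMap)) (add_zero j) := by
    rw [Ext.smul_eq_comp_mk₀, Ext.comp_assoc_of_third_deg_zero, Ext.mk₀_comp_mk₀]
    have : s • 𝟙 (ModuleCat.of R W) ≫ ModuleCat.ofHom e.symm.toLinearMap = 𝟙 _ := by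
      ext y
      exact e.apply_symm_apply y
    rw [Linear.smul_comp] 
    rw [this, Ext.comp_mk₀_id]
  rw [h2, h1, Ext.zero_comp]

end ExtVan


section LocReg
open IsLocalRing

variable {R : Type} [CommRing R]

/-- `l` is a regular sequence on `R/I`, locally at `lam`. -/
def GwaLocReg (lam : Ideal R) : Ideal R → List R → Prop
  | _, [] => True
  | I, x :: l => (∀ b, b * x ∈ I → ∃ s, s ∉ lam ∧ s * b ∈ I) ∧
      GwaLocReg lam (I ⊔ Ideal.span {x}) l

theorem gwa_mem_map_loc (lam : Ideal R) [lam.IsPrime] (I : Ideal R) (b : R)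
    (h : algebraMap R (Localization.AtPrime lam) b ∈
      Ideal.map (algebraMap R (Localization.AtPrime lam)) I) : ∃ s, s ∉ lam ∧ s * b ∈ I := by
  obtain ⟨s, hs, h⟩ := (IsLocalization.algebraMap_mem_map_algebraMap_iff lam.primeCompl _ I b).1 h
  exact ⟨s, hs, h⟩

theorem gwa_loc_transport (lam : Ideal R) [lam.IsPrime] : ∀ (l : List R) (I : Ideal R),
    GwaRegOn (Ideal.map (algebraMap R (Localization.AtPrime lam)) I)
      (l.map (algebraMap R (Localization.AtPrime lam))) → GwaLocReg lam I l := by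
  intro l
  induction l with
  | nil => intro I _; trivial
  | cons x l ih =>
    intro I h
    refine ⟨fun b hb => gwa_mem_map_loc lam I b (h.1 _ ?_), ih _ ?_⟩
    · rw [← map_mul]; exact Ideal.mem_map_of_mem _ hb
    · have := h.2
      rwa [Ideal.map_sup, Ideal.map_span, Set.image_singleton]

theorem gwa_loc_exists [IsNoetherianRing R] (lam : Ideal R) [lam.IsPrime] (d : ℕ)
    (hd : ringKrullDim (Localization.AtPrime lam) = (d : WithBot (WithTop ℕ)))
    (hs : ∃ s : Finset (Localization.AtPrime lam), s.card = d ∧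
          Ideal.span (s : Set (Localization.AtPrime lam))
            = IsLocalRing.maximalIdeal (Localization.AtPrime lam)) :
    ∃ l : List R, l.length = d ∧ Ideal.ofList l ≤ lam ∧ GwaLocReg lam ⊥ l ∧
      ∀ y ∈ lam, ∃ s, s ∉ lam ∧ s * y ∈ Ideal.ofList l := by
  classical
  obtain ⟨s, hsc, hsp⟩ := hs
  have hnum : ∀ z : Localization.AtPrime lam, ∃ a : R, ∃ u : lam.primeCompl,
      z * algebraMap R _ (u : R) = algebraMap R _ a := fun z => by
    obtain ⟨⟨a, u⟩, h⟩ := IsLocalization.surj lam.primeCompl z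
    exact ⟨a, u, h⟩
  choose num den hnd using hnum
  have hspan : Ideal.ofList ((s.toList.map num).map (algebraMap R (Localization.AtPrime lam)))
      = maximalIdeal (Localization.AtPrime lam) := by
    rw [← hsp]
    apply le_antisymm
    · rw [Ideal.ofList, Ideal.span_le]
      intro z hz
      simp only [List.map_map, List.mem_map, Set.mem_ofPred_eq, Finset.mem_toList,
        Function.comp] at hz
      obtain ⟨w, hw, rfl⟩ := hz
      rw [← hnd]
      exact Ideal.mul_mem_right _ _ (Ideal.subset_span hw)
    · rw [Ideal.span_le]
      intro w hw
      have h1 : algebraMap R _ (num w) ∈ Ideal.ofList ((s.toList.map num).map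
          (algebraMap R (Localization.AtPrime lam))) := by
        apply Ideal.subset_span
        simp only [List.map_map, List.mem_map, Set.mem_ofPred_eq, Finset.mem_toList,
          Function.comp]
        exact ⟨w, hw, rfl⟩
      rw [← hnd] at h1
      exact (Ideal.mul_unit_mem_iff_mem _ (IsLocalization.map_units _ (den w))).1 h1
  have hmapof : Ideal.map (algebraMap R (Localization.AtPrime lam))
      (Ideal.ofList (s.toList.map num)) = maximalIdeal (Localization.AtPrime lam) := by
    rw [← hspan, Ideal.map_ofList]
  refine ⟨s.toList.map num, by simp [hsc], ?_, ?_, ?_⟩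
  · have h := IsLocalization.AtPrime.under_maximalIdeal (Localization.AtPrime lam) lam
    have h2 := Ideal.le_comap_map (f := algebraMap R (Localization.AtPrime lam))
      (I := Ideal.ofList (s.toList.map num))
    rw [hmapof] at h2
    exact h2.trans (le_of_eq h)
  · apply gwa_loc_transport
    apply gwa_reg_list
    · rw [hspan, Ideal.map_bot, bot_sup_eq]
    · rw [Ideal.map_bot, ringKrullDim_eq_of_ringEquiv (RingEquiv.quotientBot _), hd]
      simp [hsc]
      exact le_rfl
  · intro y hy
    apply gwa_mem_map_loc
    rw [hmapof, ← Localization.AtPrime.map_eq_maximalIdeal]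
    exact Ideal.mem_map_of_mem _ hy

end LocReg

section ExtLoc

variable {R : Type} [CommRing R]

/-- `lam`-power torsion modules. -/
def GwaTors (lam : Ideal R) (W : Type) [AddCommGroup W] [Module R W] : Prop :=
  ∀ w : W, ∃ n : ℕ, ∀ r ∈ lam ^ n, r • w = 0

theorem gwa_tors_coprime (lam : Ideal R) (hl : lam.IsMaximal) (s : R) (hs : s ∉ lam) (n : ℕ) :
    ∃ a, ∃ b ∈ lam ^ n, a * s + b = 1 := by
  have h1 : IsCoprime (Ideal.span {s}) (lam ^ n) := by
    apply IsCoprime.pow_right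
    rw [Ideal.isCoprime_iff_sup_eq, sup_comm]
    exact hl.1.2 _ (lt_of_le_of_ne le_sup_left (fun h => hs (by
      rw [h]; exact Ideal.mem_sup_right (Ideal.mem_span_singleton_self s))))
  obtain ⟨i, hi, j, hj, hij⟩ := Ideal.isCoprime_iff_exists.1 h1
  obtain ⟨a, rfl⟩ := Ideal.mem_span_singleton'.1 hi
  exact ⟨a, j, hj, hij⟩

theorem gwa_tors_bij (lam : Ideal R) (hl : lam.IsMaximal) (s : R) (hs : s ∉ lam)
    {W : Type} [AddCommGroup W] [Module R W] (hW : GwaTors lam W) :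
    Function.Bijective (fun w : W => s • w) := by
  have key : ∀ w : W, ∃ a : R, (a * s) • w = w := by
    intro w
    obtain ⟨n, hn⟩ := hW w
    obtain ⟨a, b, hb, hab⟩ := gwa_tors_coprime lam hl s hs n
    refine ⟨a, ?_⟩
    have := congrArg (fun z => z • w) hab
    simpa [add_smul, hn b hb] using this
  constructor
  · intro w w' h
    obtain ⟨a, ha⟩ := key (w - w')
    have h' : s • (w - w') = 0 := by rw [smul_sub, sub_eq_zero]; exact h
    rw [mul_smul, h', smul_zero] at ha
    exact sub_eq_zero.1 ha.symm
  · intro w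
    obtain ⟨a, ha⟩ := key w
    exact ⟨a • w, by simpa [smul_smul, mul_comm] using ha⟩

theorem gwa_common_s (lam : Ideal R) (hl : lam.IsPrime) {X : Type} [AddCommGroup X] [Module R X]
    [Module.Finite R X] (h : ∀ x : X, ∃ s, s ∉ lam ∧ s • x = 0) :
    ∃ s, s ∉ lam ∧ ∀ x : X, s • x = 0 := by
  obtain ⟨t, ht⟩ := Module.Finite.fg_top (R := R) (M := X)
  choose f hf hf0 using h
  refine ⟨∏ x ∈ t, f x, ?_, ?_⟩
  · intro hmem
    obtain ⟨x, _, hx⟩ := (hl.prod_mem_iff).1 hmem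
    exact hf x hx
  · intro x
    have hx : x ∈ Submodule.span R (t : Set X) := ht ▸ Submodule.mem_top
    induction hx using Submodule.span_induction with
    | mem x hx =>
      obtain ⟨c, hc⟩ := Finset.dvd_prod_of_mem f hx
      rw [hc, mul_comm, mul_smul, hf0, smul_zero]
    | zero => simp
    | add x y _ _ hx hy => rw [smul_add, hx, hy, add_zero]
    | smul a x _ hx => rw [smul_comm, hx, smul_zero]

theorem gwa_ev_step [IsNoetherianRing R] (lam : Ideal R) (hl : lam.IsMaximal)
    {W : Type} [AddCommGroup W] [Module R W] (hW : GwaTors lam W) (I : Ideal R) (x : R) (c : ℕ)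
    (hx : ∀ b, b * x ∈ I → ∃ s, s ∉ lam ∧ s * b ∈ I)
    (hI : ∀ j, c < j → GwaEV R (R ⧸ I) W j) :
    ∀ j, c + 1 < j → GwaEV R (R ⧸ (I ⊔ Ideal.span {x})) W j := by
  intro j hj
  obtain ⟨j, rfl⟩ : ∃ i, j = i + 1 := ⟨j - 1, by omega⟩
  have hj' : c < j := by omega
  let μ : (R ⧸ I) →ₗ[R] (R ⧸ I) := LinearMap.lsmul R (R ⧸ I) x
  let q : (R ⧸ I) →ₗ[R] (R ⧸ (I ⊔ Ideal.span {x})) := Submodule.factor le_sup_left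
  obtain ⟨s, hs, hsK⟩ := gwa_common_s lam hl.isPrime (X := LinearMap.ker μ) (by
    rintro ⟨b, hb⟩
    obtain ⟨b, rfl⟩ := Ideal.Quotient.mk_surjective b
    have hb' : b * x ∈ I := by
      rw [← Ideal.Quotient.eq_zero_iff_mem, mul_comm]
      exact hb
    obtain ⟨s, hs, h⟩ := hx b hb'
    exact ⟨s, hs, Subtype.ext (Ideal.Quotient.eq_zero_iff_mem.2 h)⟩)
  have hK : ∀ i, GwaEV R (LinearMap.ker μ) W i := fun i =>
    gwa_ev8 s hsK (gwa_tors_bij lam hl s hs hW) i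
  have hC : GwaEV R (LinearMap.range μ) W j := by
    obtain ⟨j, rfl⟩ : ∃ i, j = i + 1 := ⟨j - 1, by omega⟩
    refine gwa_ev1 (LinearMap.ker μ).subtype μ.rangeRestrict
      (LinearMap.ker μ).injective_subtype ?_ μ.surjective_rangeRestrict (hK j) (hI _ hj')
    intro y
    simp [Subtype.ext_iff]
  refine gwa_ev1 (LinearMap.range μ).subtype q (LinearMap.range μ).injective_subtype ?_
    ?_ hC (hI _ (by omega))
  · intro y
    obtain ⟨y, rfl⟩ := Ideal.Quotient.mk_surjective y
    have h1 : q (Ideal.Quotient.mk I y) = 0 ↔ y ∈ I ⊔ Ideal.span {x} := by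
      rw [← Ideal.Quotient.eq_zero_iff_mem]; rfl
    rw [h1]
    simp only [Submodule.coe_subtype, Subtype.range_coe_subtype, Set.mem_ofPred_eq,
      LinearMap.mem_range]
    constructor
    · intro h
      obtain ⟨i, hi, z, hz, rfl⟩ := Submodule.mem_sup.1 h
      obtain ⟨a, rfl⟩ := Ideal.mem_span_singleton'.1 hz
      refine ⟨Ideal.Quotient.mk I a, ?_⟩
      change Ideal.Quotient.mk I (x * a) = _
      rw [map_add, Ideal.Quotient.eq_zero_iff_mem.2 hi, zero_add, mul_comm]
    · rintro ⟨a, ha⟩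
      obtain ⟨a, rfl⟩ := Ideal.Quotient.mk_surjective a
      change Ideal.Quotient.mk I (x * a) = _ at ha
      rw [Ideal.Quotient.eq] at ha
      have : y = -(x * a - y) + a * x := by ring
      rw [this]
      exact add_mem (Ideal.mem_sup_left (neg_mem ha)) (Ideal.mem_sup_right
        (Ideal.mul_mem_left _ _ (Ideal.mem_span_singleton_self x)))
  · intro y
    obtain ⟨y, rfl⟩ := Ideal.Quotient.mk_surjective y
    exact ⟨Ideal.Quotient.mk I y, rfl⟩

theorem gwa_ev_list [IsNoetherianRing R] (lam : Ideal R) (hl : lam.IsMaximal)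
    {W : Type} [AddCommGroup W] [Module R W] (hW : GwaTors lam W) :
    ∀ (l : List R) (I : Ideal R) (c : ℕ), GwaLocReg lam I l →
    (∀ j, c < j → GwaEV R (R ⧸ I) W j) →
    ∀ j, c + l.length < j → GwaEV R (R ⧸ (I ⊔ Ideal.ofList l)) W j := by
  intro l
  induction l with
  | nil => 
    intro I c _ h j hj
    have : I ⊔ Ideal.ofList [] = I := by simp
    rw [this]
    exact h j (by simpa using hj)
  | cons x l ih =>
    intro I c h hI j hj
    rw [gwa_list_sup]
    exact ih _ (c + 1) h.2 (gwa_ev_step lam hl hW I x c h.1 hI) j (by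
      rw [List.length_cons] at hj; omega)

theorem gwa_ev_res [IsNoetherianRing R] (lam : Ideal R) (hl : lam.IsMaximal)
    {W : Type} [AddCommGroup W] [Module R W] (hW : GwaTors lam W) (l : List R)
    (hreg : GwaLocReg lam ⊥ l) (hle : Ideal.ofList l ≤ lam)
    (hgen : ∀ y ∈ lam, ∃ s, s ∉ lam ∧ s * y ∈ Ideal.ofList l) (j : ℕ) (hj : l.length < j) :
    GwaEV R (R ⧸ lam) W j := by
  have h0 : ∀ j, l.length < j → GwaEV R (R ⧸ Ideal.ofList l) W j := by
    intro j hj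
    have := gwa_ev_list lam hl hW l ⊥ 0 hreg (by
      intro j hj
      obtain ⟨j, rfl⟩ : ∃ i, j = i + 1 := ⟨j - 1, by omega⟩
      have : Module.Projective R (R ⧸ (⊥ : Ideal R)) :=
        Module.Projective.of_equiv (Submodule.quotEquivOfEqBot (⊥ : Ideal R) rfl).symm
      exact gwa_ev4 j) j (by omega)
    rwa [bot_sup_eq] at this
  obtain ⟨j, rfl⟩ : ∃ i, j = i + 1 := ⟨j - 1, by omega⟩
  let q : (R ⧸ Ideal.ofList l) →ₗ[R] (R ⧸ lam) := Submodule.factor hle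
  obtain ⟨s, hs, hsK⟩ := gwa_common_s lam hl.isPrime (X := LinearMap.ker q) (by
    rintro ⟨b, hb⟩
    obtain ⟨b, rfl⟩ := Ideal.Quotient.mk_surjective b
    have hb' : b ∈ lam := Ideal.Quotient.eq_zero_iff_mem.1 hb
    obtain ⟨s, hs, h⟩ := hgen b hb'
    exact ⟨s, hs, Subtype.ext (Ideal.Quotient.eq_zero_iff_mem.2 h)⟩)
  refine gwa_ev1 (LinearMap.ker q).subtype q (LinearMap.ker q).injective_subtype ?_ ?_
    (gwa_ev8 s hsK (gwa_tors_bij lam hl s hs hW) j) (h0 _ hj)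
  · intro y; simp
  · intro y
    obtain ⟨y, rfl⟩ := Ideal.Quotient.mk_surjective y
    exact ⟨Ideal.Quotient.mk _ y, rfl⟩

end ExtLoc


section ExtTors

variable {R : Type} [CommRing R]

theorem gwa_tors_pick (lam : Ideal R) {V : Type} [AddCommGroup V] [Module R V]
    (hV : GwaTors lam V) (U : Submodule R V) (hU : U ≠ ⊤) :
    ∃ w, w ∉ U ∧ ∀ r ∈ lam, r • w ∈ U := by
  classical
  obtain ⟨w0, hw0⟩ : ∃ w, w ∉ U := by
    by_contra! h
    exact hU (eq_top_iff.2 fun x _ => h x)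
  have hex : ∃ n : ℕ, ∀ r ∈ lam ^ n, r • w0 ∈ U := by
    obtain ⟨n, hn⟩ := hV w0
    exact ⟨n, fun r hr => by rw [hn r hr]; exact zero_mem _⟩
  have hn := Nat.find_spec hex
  have hmin := fun m => Nat.find_min hex (m := m)
  generalize Nat.find hex = n at hn hmin
  cases n with
  | zero => exact absurd (by simpa using hn 1 (by simp)) hw0
  | succ n =>
    have := hmin n (Nat.lt_succ_self n)
    push Not at this
    obtain ⟨s, hs, hsU⟩ := this
    refine ⟨s • w0, hsU, fun r hr => ?_⟩
    rw [smul_smul]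
    exact hn _ (by rw [pow_succ']; exact Ideal.mul_mem_mul hr hs)

variable {W I W' : Type} [AddCommGroup W] [Module R W] [AddCommGroup I] [Module R I]
  [AddCommGroup W'] [Module R W']

theorem gwa_zorn (lam : Ideal R) (hl : lam.IsMaximal) {V : Type} [AddCommGroup V] [Module R V]
    (hV : GwaTors lam V) (f : W →ₗ[R] I) (g : I →ₗ[R] W') (hf : Function.Injective f)
    (hfg : Function.Exact f g) (hg : Function.Surjective g) (hEV : GwaEV R (R ⧸ lam) W 1)
    (h : V →ₗ[R] W') : ∃ ψ : V →ₗ[R] I, g ∘ₗ ψ = h := by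
  classical
  let S : Set (V →ₗ.[R] I) := {p | ∀ x : p.domain, g (p x) = h x}
  have hz : ∃ p, Maximal (· ∈ S) p := by
    apply zorn_le₀
    intro c hcS hc
    have hd : DirectedOn (· ≤ ·) c := hc.directedOn
    by_cases hne : c.Nonempty
    · refine ⟨LinearPMap.sSup c hd, ?_, fun z hz => LinearPMap.le_sSup hd hz⟩
      rintro ⟨x, hx⟩
      obtain ⟨p, hp, hxp⟩ := (LinearPMap.mem_domain_sSup_iff hne hd).1 hx
      have := LinearPMap.sSup_apply hd hp ⟨x, hxp⟩
      have h2 := hcS hp ⟨x, hxp⟩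
      rw [← this] at h2
      exact h2
    · rw [Set.not_nonempty_iff_eq_empty] at hne
      subst hne
      refine ⟨⊥, ?_, by simp⟩
      rintro ⟨x, hx⟩
      have hx' : x = 0 := (Submodule.mem_bot R).1 hx
      subst hx'
      have : (⟨0, hx⟩ : (⊥ : V →ₗ.[R] I).domain) = 0 := rfl
      rw [this]
      simp
  obtain ⟨p, hpS, hpmax⟩ := hz
  have htop : p.domain = ⊤ := by
    by_contra hU
    obtain ⟨w, hw, hlw⟩ := gwa_tors_pick lam hV p.domain hU
    have hrl : ∀ r : R, r • w ∈ p.domain → r ∈ lam := by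
      intro r hr
      by_contra hrl
      obtain ⟨a, b, hb, hab⟩ := gwa_tors_coprime lam hl r hrl 1
      rw [pow_one] at hb
      apply hw
      have : w = a • (r • w) + b • w := by
        rw [smul_smul, ← add_smul, hab, one_smul]
      rw [this]
      exact add_mem (Submodule.smul_mem _ _ hr) (hlw b hb)
    obtain ⟨y0, hy0⟩ := hg (h w)
    let m : lam →ₗ[R] p.domain :=
      { toFun := fun r => ⟨(r : R) • w, hlw r r.2⟩
        map_add' := fun a b => Subtype.ext (by simp [add_smul])
        map_smul' := fun a b => Subtype.ext (by simp [mul_smul]) }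
    let e : lam →ₗ[R] I := p.toFun ∘ₗ m - (LinearMap.toSpanSingleton R I y0) ∘ₗ lam.subtype
    have he : ∀ r, e r ∈ LinearMap.range f := by
      intro r
      obtain ⟨z, hz⟩ := (hfg (e r)).1 (by
        have h1 : g (p (m r)) = h (m r : V) := hpS (m r)
        change g (p (m r) - (r : R) • y0) = 0
        rw [map_sub, h1, map_smul, hy0]
        simp [m])
      exact ⟨z, hz⟩
    let c : lam →ₗ[R] W := (LinearEquiv.ofInjective f hf).symm.toLinearMap ∘ₗ
      (e.codRestrict (LinearMap.range f) he)
    have hc : ∀ r, f (c r) = e r := by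
      intro r
      have := LinearEquiv.apply_symm_apply (LinearEquiv.ofInjective f hf)
        (e.codRestrict (LinearMap.range f) he r)
      exact congrArg Subtype.val this
    obtain ⟨ψ, hψ⟩ := gwa_ev7 (lam.subtype) (Submodule.mkQ lam) lam.injective_subtype
      (by intro y; simp [Ideal.Quotient.eq_zero_iff_mem]) (Submodule.mkQ_surjective lam) hEV c
    let y := y0 + f (ψ 1)
    have hy : ∀ (r : R) (hr : r • w ∈ p.domain), p ⟨r • w, hr⟩ = r • y := by
      intro r hr
      have h1 := hc ⟨r, hrl r hr⟩
      have h2 : ψ r = c ⟨r, hrl r hr⟩ := by rw [← hψ]; rfl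
      have h3 : r • ψ 1 = ψ r := by rw [← map_smul, smul_eq_mul, mul_one]
      have h4 : e ⟨r, hrl r hr⟩ = p ⟨r • w, hr⟩ - r • y0 := rfl
      rw [smul_add, ← map_smul, h3, h2, h1, h4]
      abel
    have hw0 : ∀ r : R, r • w = 0 → (RingHom.id R) r • y = 0 := by
      intro r hr
      rw [RingHom.id_apply]
      have h0 : r • w ∈ p.domain := by rw [hr]; exact zero_mem _
      rw [← hy r h0]
      have : (⟨r • w, h0⟩ : p.domain) = 0 := Subtype.ext hr
      rw [this, LinearPMap.map_zero]
    let q : V →ₗ.[R] I := LinearPMap.mkSpanSingleton' w y hw0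
    have hq : ∀ (r : R) (hr : r • w ∈ q.domain), q ⟨r • w, hr⟩ = r • y := fun r hr =>
      LinearPMap.mkSpanSingleton'_apply w y hw0 r hr
    have hcompat : ∀ (x : p.domain) (z : q.domain), (x : V) = z → p x = q z := by
      rintro ⟨x, hx⟩ ⟨z, hz⟩ hxz
      change x = z at hxz
      subst hxz
      obtain ⟨r, rfl⟩ := Submodule.mem_span_singleton.1 hz
      rw [hy r hx]
      exact (hq r hz).symm
    have hle := hpmax (y := p.sup q hcompat) (by
      rintro ⟨x, hx⟩
      obtain ⟨a, ha, b, hb, rfl⟩ := Submodule.mem_sup.1 hx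
      obtain ⟨r, rfl⟩ := Submodule.mem_span_singleton.1 hb
      have h5 := LinearPMap.sup_apply hcompat ⟨a, ha⟩ ⟨r • w, hb⟩ ⟨_, hx⟩ rfl
      refine (congrArg g h5).trans ?_
      rw [hq r hb, map_add, map_smul, map_add g, hy0, (hfg (f (ψ 1))).2 ⟨_, rfl⟩, hpS ⟨a, ha⟩]
      simp) (LinearPMap.left_le_sup p q hcompat)
    exact hw (hle.1 (Submodule.mem_sup_right (Submodule.mem_span_singleton_self w)))
  refine ⟨p.toFun ∘ₗ (LinearMap.id.codRestrict p.domain (fun x => htop ▸ Submodule.mem_top)), ?_⟩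
  ext x
  exact hpS _

theorem gwa_ev_tors (lam : Ideal R) (hl : lam.IsMaximal) {V : Type} [AddCommGroup V] [Module R V]
    (hV : GwaTors lam V) : ∀ (j : ℕ) (W : Type) [AddCommGroup W] [Module R W],
    GwaEV R (R ⧸ lam) W (j + 1) → GwaEV R V W (j + 1) := by
  have hinj : ∀ (W : Type) [AddCommGroup W] [Module R W], ∃ (I : ModuleCat.{0} R)
      (f : W →ₗ[R] I), Function.Injective f ∧ CategoryTheory.Injective I := by
    intro W _ _
    obtain ⟨⟨J, hJ, f, hf⟩⟩ := CategoryTheory.EnoughInjectives.presentation (ModuleCat.of R W)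
    exact ⟨J, f.hom, (ModuleCat.mono_iff_injective _).mp inferInstance, hJ⟩
  intro j
  induction j with
  | zero =>
    intro W _ _ h
    obtain ⟨I, f, hf, hI⟩ := hinj W
    have hex : Function.Exact f (LinearMap.range f).mkQ := by
      intro y; simp
    exact gwa_ev5' (X₂ := I) f (LinearMap.range f).mkQ hf hex (Submodule.mkQ_surjective _) hI
      (fun φ => gwa_zorn lam hl hV f _ hf hex (Submodule.mkQ_surjective _) h φ)
  | succ j ih =>
    intro W _ _ h
    obtain ⟨I, f, hf, hI⟩ := hinj W
    have hex : Function.Exact f (LinearMap.range f).mkQ := by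
      intro y; simp
    have key := fun (Y : Type) [AddCommGroup Y] [Module R Y] =>
      gwa_ev5 (X₂ := I) (W := Y) (j := j) f (LinearMap.range f).mkQ hf hex
        (Submodule.mkQ_surjective _) hI
    exact (key V).2 (ih _ ((key _).1 h))

theorem gwa_ev_main [IsNoetherianRing R] (lam : Ideal R) [lam.IsPrime] (hl : lam.IsMaximal) (d : ℕ)
    (hd : ringKrullDim (Localization.AtPrime lam) = (d : WithBot (WithTop ℕ)))
    (hs : ∃ s : Finset (Localization.AtPrime lam), s.card = d ∧
          Ideal.span (s : Set (Localization.AtPrime lam))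
            = IsLocalRing.maximalIdeal (Localization.AtPrime lam))
    {V W : Type} [AddCommGroup V] [Module R V] [AddCommGroup W] [Module R W]
    (hV : GwaTors lam V) (hW : GwaTors lam W) (j : ℕ) (hj : d < j) : GwaEV R V W j := by
  obtain ⟨l, hl1, hl2, hl3, hl4⟩ := gwa_loc_exists lam d hd hs
  obtain ⟨j, rfl⟩ : ∃ i, j = i + 1 := ⟨j - 1, by omega⟩
  exact gwa_ev_tors lam hl hV j W (gwa_ev_res lam hl hW l hl3 hl2 hl4 _ (by omega))

end ExtTors


noncomputable section GradedBasics

variable {R : Type} [CommRing R] [Algebra ℂ R] {σ : R ≃ₐ[ℂ] R} {v : R} {G : GWA R σ v}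

theorem gwa_isInternal (X : GradedMod G) : DirectSum.IsInternal X.deg := by
  classical
  constructor
  · rw [injective_iff_map_eq_zero]
    intro x hx
    rw [DirectSum.coeAddMonoidHom_eq_dfinsuppSum, DFinsupp.sum] at hx
    ext i
    by_cases hi : i ∈ DFinsupp.support x
    · have := X.indep _ (fun i => (x i : X.M)) (fun i => (x i).2) hx i hi
      simpa using this
    · simp only [DFinsupp.mem_support_toFun, not_not] at hi
      rw [hi]; rfl
  · intro m
    obtain ⟨s, g, hg, rfl⟩ := X.decomp m
    refine ⟨∑ i ∈ s, DirectSum.of (fun i => X.deg i) i ⟨g i, hg i⟩, ?_⟩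
    rw [map_sum]
    simp

/-- Projection to the degree `i` component. -/
def GradedMod.pr (X : GradedMod G) (i : ℤ) : X.M →+ X.M :=
  letI : DirectSum.Decomposition X.deg := (gwa_isInternal X).chooseDecomposition
  (X.deg i).subtype.comp ((DFinsupp.evalAddMonoidHom i).comp
    (DirectSum.decomposeAddEquiv X.deg).toAddMonoidHom)

theorem gwa_pr_mem (X : GradedMod G) (i : ℤ) (m : X.M) : X.pr i m ∈ X.deg i := by
  exact SetLike.coe_mem _

theorem gwa_pr_same (X : GradedMod G) {i : ℤ} {m : X.M} (h : m ∈ X.deg i) : X.pr i m = m := by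
  let _ : DirectSum.Decomposition X.deg := (gwa_isInternal X).chooseDecomposition
  exact DirectSum.decompose_of_mem_same X.deg h

theorem gwa_pr_ne (X : GradedMod G) {i j : ℤ} {m : X.M} (h : m ∈ X.deg i) (hij : i ≠ j) :
    X.pr j m = 0 := by
  let _ : DirectSum.Decomposition X.deg := (gwa_isInternal X).chooseDecomposition
  exact DirectSum.decompose_of_mem_ne X.deg h hij

theorem gwa_pr_sum (X : GradedMod G) (m : X.M) : ∃ s : Finset ℤ, m = ∑ i ∈ s, X.pr i m := by
  classical
  let _ : DirectSum.Decomposition X.deg := (gwa_isInternal X).chooseDecomposition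
  exact ⟨_, (DirectSum.sum_support_decompose X.deg m).symm⟩

theorem gwa_ext_pr (X : GradedMod G) {m : X.M} (h : ∀ i, X.pr i m = 0) : m = 0 := by
  obtain ⟨s, hs⟩ := gwa_pr_sum X m
  rw [hs]
  exact Finset.sum_eq_zero fun i _ => h i

/-- Induction on homogeneous components. -/
theorem gwa_hom_ind (X : GradedMod G) {p : X.M → Prop} (h0 : p 0)
    (hadd : ∀ a b, p a → p b → p (a + b)) (hh : ∀ i, ∀ m ∈ X.deg i, p m) (m : X.M) : p m := by
  obtain ⟨s, g, hg, rfl⟩ := X.decomp m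
  exact Finset.sum_induction g p hadd h0 (fun i _ => hh i _ (hg i))

/-- The regular graded module. -/
def gwaReg (G : GWA R σ v) : GradedMod G where
  M := G.A
  deg := G.deg
  smul_mem := fun ha hm => G.mul_mem ha hm
  decomp := G.decomp
  indep := G.indep

theorem gwa_alg_ind (G : GWA R σ v) {p : G.A → Prop} (h0 : p 0)
    (hadd : ∀ a b, p a → p b → p (a + b)) (hh : ∀ i, ∀ m ∈ G.deg i, p m) (a : G.A) : p a :=
  gwa_hom_ind (gwaReg G) h0 hadd hh a

/-- Projection of the algebra to its degree `i` component. -/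
def gwaPr (G : GWA R σ v) (i : ℤ) : G.A →+ G.A := (gwaReg G).pr i

theorem gwa_apr_mem (i : ℤ) (a : G.A) : gwaPr G i a ∈ G.deg i := gwa_pr_mem (gwaReg G) i a

theorem gwa_apr_same {i : ℤ} {a : G.A} (h : a ∈ G.deg i) : gwaPr G i a = a :=
  gwa_pr_same (gwaReg G) h

theorem gwa_apr_ne {i j : ℤ} {a : G.A} (h : a ∈ G.deg i) (hij : i ≠ j) : gwaPr G j a = 0 :=
  gwa_pr_ne (gwaReg G) h hij

theorem gwa_apr_sum (a : G.A) : ∃ s : Finset ℤ, a = ∑ i ∈ s, gwaPr G i a :=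
  gwa_pr_sum (gwaReg G) a

theorem gwa_pr_smul (X : GradedMod G) {i : ℤ} {m : X.M} (hm : m ∈ X.deg i) (j : ℤ) (a : G.A) :
    X.pr j (a • m) = gwaPr G (j - i) a • m := by
  induction a using gwa_alg_ind with
  | h0 => rw [zero_smul, map_zero, map_zero, zero_smul]
  | hadd a b ha hb =>
    rw [add_smul, map_add, ha, hb, map_add, add_smul]
  | hh k a ha =>
    by_cases h : k + i = j
    · subst h
      rw [gwa_pr_same X (X.smul_mem ha hm), add_sub_cancel_right, gwa_apr_same ha]
    · rw [gwa_pr_ne X (X.smul_mem ha hm) h, gwa_apr_ne ha (by omega), zero_smul]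

theorem gwa_pr_smul' (X : GradedMod G) {k : ℤ} {a : G.A} (ha : a ∈ G.deg k) (j : ℤ) (m : X.M) :
    X.pr j (a • m) = a • X.pr (j - k) m := by
  induction m using gwa_hom_ind with
  | h0 => simp
  | hadd x y hx hy => rw [smul_add, map_add, hx, hy, map_add, smul_add]
  | hh i m hm =>
    by_cases h : k + i = j
    · subst h
      rw [gwa_pr_same X (X.smul_mem ha hm), add_sub_cancel_left, gwa_pr_same X hm]
    · rw [gwa_pr_ne X (X.smul_mem ha hm) h, gwa_pr_ne X hm (by omega), smul_zero]

theorem gwa_gsub_iff (X : GradedMod G) (N : Submodule G.A X.M) :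
    IsGradedSub X N ↔ ∀ m ∈ N, ∀ i, X.pr i m ∈ N := by
  classical
  constructor
  · intro h m hm i
    obtain ⟨s, g, hg, hgN, rfl⟩ := h m hm
    rw [map_sum]
    refine Submodule.sum_mem _ fun j _ => ?_
    by_cases hij : j = i
    · subst hij; rw [gwa_pr_same X (hg _)]; exact hgN _
    · rw [gwa_pr_ne X (hg j) hij]; exact zero_mem _
  · intro h m hm
    obtain ⟨s, hs⟩ := gwa_pr_sum X m
    exact ⟨s, fun i => X.pr i m, fun i => gwa_pr_mem X i m, fun i => h m hm i, hs⟩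

theorem gwa_map_pr {X Y : GradedMod G} (f : X.M →+ Y.M) (n : ℤ)
    (hf : ∀ i, ∀ m ∈ X.deg i, f m ∈ Y.deg (i + n)) (i : ℤ) (m : X.M) :
    f (X.pr i m) = Y.pr (i + n) (f m) := by
  induction m using gwa_hom_ind with
  | h0 => simp
  | hadd x y hx hy => rw [map_add, map_add, map_add, map_add, hx, hy]
  | hh j m hm =>
    by_cases h : j = i
    · subst h
      rw [gwa_pr_same X hm, gwa_pr_same Y (hf _ _ hm)]
    · rw [gwa_pr_ne X hm h, gwa_pr_ne Y (hf _ _ hm) (by omega), map_zero]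

theorem gwa_deg_disj (X : GradedMod G) {i j : ℤ} {m : X.M} (hi : m ∈ X.deg i) (hj : m ∈ X.deg j)
    (h : m ≠ 0) : i = j := by
  by_contra hij
  exact h (by rw [← gwa_pr_same X hj, gwa_pr_ne X hi hij])

theorem gwa_span_graded (X : GradedMod G) {i : ℤ} {x : X.M} (hx : x ∈ X.deg i) :
    IsGradedSub X (Submodule.span G.A {x}) := by
  rw [gwa_gsub_iff]
  intro m hm j
  obtain ⟨a, rfl⟩ := Submodule.mem_span_singleton.1 hm
  rw [gwa_pr_smul X hx]
  exact Submodule.smul_mem _ _ (Submodule.mem_span_singleton_self x)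

/-- Quotient of a graded module by a graded submodule. -/
def gwaQuot (X : GradedMod G) (P : Submodule G.A X.M) (hP : IsGradedSub X P) : GradedMod G where
  M := X.M ⧸ P
  deg i := (X.deg i).map P.mkQ.toAddMonoidHom
  smul_mem := by
    rintro i j a m ha ⟨m, hm, rfl⟩
    exact ⟨a • m, X.smul_mem ha hm, map_smul P.mkQ a m⟩
  decomp := by
    intro m
    obtain ⟨m, rfl⟩ := P.mkQ_surjective m
    obtain ⟨s, g, hg, rfl⟩ := X.decomp m
    exact ⟨s, fun i => P.mkQ (g i), fun i => ⟨g i, hg i, rfl⟩, map_sum P.mkQ _ _⟩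
  indep := by
    intro s g hg h0 i hi
    choose f hf hfg using hg
    have h1 : ∑ i ∈ s, f i ∈ P := by
      rw [← Submodule.Quotient.mk_eq_zero, ← Submodule.mkQ_apply, map_sum, ← h0]
      exact Finset.sum_congr rfl fun i _ => hfg i
    have h2 := (gwa_gsub_iff X P).1 hP _ h1 i
    rw [map_sum, Finset.sum_eq_single i, gwa_pr_same X (hf i)] at h2
    · rw [← hfg i]
      exact (Submodule.Quotient.mk_eq_zero P).2 h2
    · intro j _ hji
      exact gwa_pr_ne X (hf j) hji
    · intro h; exact absurd hi h

/-- Shift. -/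
def gwaShift (X : GradedMod G) (k : ℤ) : GradedMod G where
  M := X.M
  deg i := X.deg (i + k)
  smul_mem := by
    intro i j a m ha hm
    rw [add_assoc]
    exact X.smul_mem ha hm
  decomp := by
    classical
    intro m
    obtain ⟨s, g, hg, h⟩ := X.decomp m
    refine ⟨s.image (fun i => i - k), fun i => g (i + k), fun i => hg _, ?_⟩
    rw [Finset.sum_image (by intro a _ b _ h; simpa using h)]
    simpa using h
  indep := by
    classical
    intro s g hg h0 i hi
    have := X.indep (s.image (fun i => i + k)) (fun i => g (i - k))
      (fun i => by have := hg (i - k); rwa [sub_add_cancel] at this)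
      (by rw [Finset.sum_image (by intro a _ b _ h; simpa using h)]; simpa using h0) (i + k)
      (Finset.mem_image_of_mem _ hi)
    simpa using this

theorem gwa_shift_gsub (X : GradedMod G) (k : ℤ) (N : Submodule G.A X.M) :
    IsGradedSub (gwaShift X k) N ↔ IsGradedSub X N := by
  have h : ∀ i m, (gwaShift X k).pr i m = X.pr (i + k) m := fun i m => by
    have := gwa_map_pr (X := gwaShift X k) (Y := X) (AddMonoidHom.id _) k (fun i m hm => hm) i m
    exact this
  refine (gwa_gsub_iff (gwaShift X k) N).trans (Iff.trans ?_ (gwa_gsub_iff X N).symm)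
  constructor
  · intro hN m hm i
    have h1 : X.pr (i - k + k) m ∈ N :=
      (congrArg (fun z : X.M => z ∈ N) (h (i - k) m)).mp (hN m hm (i - k))
    rwa [sub_add_cancel] at h1
  · intro hN m hm i
    exact (congrArg (fun z : X.M => z ∈ N) (h i m)).mpr (hN m hm (i + k))

/-- product -/
def gwaProd (X Y : GradedMod G) : GradedMod G where
  M := X.M × Y.M
  deg i := (X.deg i).prod (Y.deg i)
  smul_mem := by
    intro i j a m ha hm
    exact ⟨X.smul_mem ha hm.1, Y.smul_mem ha hm.2⟩
  decomp := by
    classical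
    rintro ⟨x, y⟩
    have key : ∀ (Z : GradedMod G) (z : Z.M) (s : Finset ℤ), z = ∑ i ∈ s, Z.pr i z →
        ∀ t, s ⊆ t → z = ∑ i ∈ t, Z.pr i z := by
      intro Z z s hs t hst
      conv_lhs => rw [hs]
      refine Finset.sum_subset hst fun i _ hi => ?_
      rw [hs, map_sum]
      exact Finset.sum_eq_zero fun j hj => gwa_pr_ne Z (gwa_pr_mem Z j z)
        (fun h => hi (h ▸ hj))
    obtain ⟨s, hs⟩ := gwa_pr_sum X x
    obtain ⟨t, ht⟩ := gwa_pr_sum Y y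
    refine ⟨s ∪ t, fun i => (X.pr i x, Y.pr i y), fun i => ⟨gwa_pr_mem X i x, gwa_pr_mem Y i y⟩, ?_⟩
    apply Prod.ext
    · rw [Prod.fst_sum]; exact key X x s hs _ Finset.subset_union_left
    · rw [Prod.snd_sum]; exact key Y y t ht _ Finset.subset_union_right
  indep := by
    intro s g hg h0 i hi
    apply Prod.ext
    · exact X.indep s (fun i => (g i).1) (fun i => (hg i).1) (by rw [← Prod.fst_sum, h0]; rfl) i hi
    · exact Y.indep s (fun i => (g i).2) (fun i => (hg i).2) (by rw [← Prod.snd_sum, h0]; rfl) i hi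

end GradedBasics


noncomputable section GwaAlg

variable {R : Type} [CommRing R] [Algebra ℂ R] {σ : R ≃ₐ[ℂ] R} {v : R} {G : GWA R σ v}

theorem gwa_comm_tp (n : ℕ) (r : R) : G.emb r * G.tp ^ n = G.tp ^ n * G.emb ((σ ^ (n : ℤ)) r) := by
  induction n generalizing r with
  | zero => simp
  | succ n ih =>
    rw [pow_succ', ← mul_assoc, G.rel1, mul_assoc, ih, ← mul_assoc]
    congr 2

theorem gwa_comm_tm (n : ℕ) (r : R) :
    G.emb r * G.tm ^ n = G.tm ^ n * G.emb ((σ ^ (-(n : ℤ))) r) := by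
  induction n generalizing r with
  | zero => simp
  | succ n ih =>
    have h : G.emb r * G.tm = G.tm * G.emb ((σ ^ (-1 : ℤ)) r) := by
      rw [← G.rel2, ← AlgEquiv.mul_apply]; simp
    rw [pow_succ', ← mul_assoc, h, mul_assoc, ih, ← mul_assoc]
    congr 2
    rw [← AlgEquiv.mul_apply, ← zpow_add]
    push_cast; congr 2; ring

theorem gwa_comm {i : ℤ} {a : G.A} (ha : a ∈ G.deg i) (r : R) :
    G.emb r * a = a * G.emb ((σ ^ i) r) := by
  obtain ⟨n, rfl | rfl⟩ := i.eq_nat_or_neg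
  · obtain ⟨s, hs, -⟩ := G.free_pos n a ha
    rw [hs, ← mul_assoc, ← map_mul, mul_comm r s, map_mul, mul_assoc, gwa_comm_tp, mul_assoc]
  · obtain ⟨s, hs, -⟩ := G.free_neg n a ha
    rw [hs, ← mul_assoc, ← map_mul, mul_comm r s, map_mul, mul_assoc, gwa_comm_tm, mul_assoc]

theorem gwa_deg0 {a : G.A} (ha : a ∈ G.deg 0) : ∃ r, a = G.emb r := by
  obtain ⟨s, hs, -⟩ := G.free_pos 0 a ha
  exact ⟨s, by simpa using hs⟩

theorem gwa_one_mem (G : GWA R σ v) : (1 : G.A) ∈ G.deg 0 := by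
  rw [← map_one G.emb]; exact G.emb_mem 1

theorem gwa_tp_mem (n : ℕ) : G.tp ^ n ∈ G.deg n := by
  induction n with
  | zero => simpa using gwa_one_mem G
  | succ n ih => rw [pow_succ]; push_cast; exact G.mul_mem ih G.tp_mem

theorem gwa_tm_mem (n : ℕ) : G.tm ^ n ∈ G.deg (-(n : ℤ)) := by
  induction n with
  | zero => simpa using gwa_one_mem G
  | succ n ih => rw [pow_succ]; push_cast; rw [neg_add]; exact G.mul_mem ih G.tm_mem

/-- the basis element in degree `k` -/
def gwaT (G : GWA R σ v) (k : ℤ) : G.A := if 0 ≤ k then G.tp ^ k.toNat else G.tm ^ (-k).toNat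

theorem gwaT_pos (n : ℕ) : gwaT G n = G.tp ^ n := by simp [gwaT]

theorem gwaT_neg (n : ℕ) : gwaT G (-(n : ℤ)) = G.tm ^ n := by
  cases n with
  | zero => simp [gwaT]
  | succ n => rw [gwaT, if_neg (by push_cast; omega)]; simp

theorem gwaT_mem (k : ℤ) : gwaT G k ∈ G.deg k := by
  obtain ⟨n, rfl | rfl⟩ := k.eq_nat_or_neg
  · rw [gwaT_pos]; exact gwa_tp_mem n
  · rw [gwaT_neg]; exact gwa_tm_mem n

theorem gwaT_span {k : ℤ} {a : G.A} (ha : a ∈ G.deg k) : ∃ r, a = gwaT G k * G.emb r := by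
  obtain ⟨n, rfl | rfl⟩ := k.eq_nat_or_neg
  · obtain ⟨s, hs, -⟩ := G.free_pos n a ha
    exact ⟨_, by rw [hs, gwaT_pos, gwa_comm_tp]⟩
  · obtain ⟨s, hs, -⟩ := G.free_neg n a ha
    exact ⟨_, by rw [hs, gwaT_neg, gwa_comm_tm]⟩

theorem gwaT_inj {k : ℤ} {r : R} (h : gwaT G k * G.emb r = 0) : r = 0 := by
  have h1 : G.emb ((σ ^ (-k)) r) * gwaT G k = 0 := by
    rw [gwa_comm (gwaT_mem k), ← AlgEquiv.mul_apply, ← zpow_add]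
    simpa using h
  have h2 : (σ ^ (-k)) r = 0 := by
    obtain ⟨n, rfl | rfl⟩ := k.eq_nat_or_neg
    · rw [gwaT_pos] at h1
      exact (G.free_pos n 0 (zero_mem _)).unique h1.symm (by simp)
    · rw [gwaT_neg] at h1
      exact (G.free_neg n 0 (zero_mem _)).unique h1.symm (by simp)
  exact (EmbeddingLike.map_eq_zero_iff (f := σ ^ (-k))).1 h2

theorem gwa_emb_smul_mem (X : GradedMod G) {i : ℤ} {m : X.M} (hm : m ∈ X.deg i) (r : R) :
    G.emb r • m ∈ X.deg i := by
  have := X.smul_mem (G.emb_mem r) hm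
  rwa [zero_add] at this

theorem gwa_pr_emb (X : GradedMod G) (i : ℤ) (r : R) (m : X.M) :
    X.pr i (G.emb r • m) = G.emb r • X.pr i m := by
  rw [gwa_pr_smul' X (G.emb_mem r), sub_zero]

theorem gwa_kill_unit (X : GradedMod G) {I : Ideal R} (hI : I.IsMaximal) {x : X.M}
    (hx : ∀ r ∈ I, G.emb r • x = 0) {r : R} (hr : r ∉ I) : ∃ s, G.emb s • G.emb r • x = x := by
  obtain ⟨y, hy⟩ := hI.exists_inv hr
  refine ⟨y, ?_⟩
  obtain ⟨i, hi, h⟩ := hy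
  have h1 := congrArg (fun z => G.emb z • x) h
  simp only [map_add, add_smul, hx i hi, add_zero, map_one, one_smul, map_mul, mul_smul] at h1
  exact h1

theorem gwa_kill_mem (X : GradedMod G) {I : Ideal R} (hI : I.IsMaximal) {x : X.M} (h0 : x ≠ 0)
    (hx : ∀ r ∈ I, G.emb r • x = 0) {r : R} (hr : G.emb r • x = 0) : r ∈ I := by
  by_contra h
  obtain ⟨s, hs⟩ := gwa_kill_unit X hI hx h
  rw [hr, smul_zero] at hs
  exact h0 hs.symm

theorem gwa_kill_eq (X : GradedMod G) {I J : Ideal R} (hI : I.IsMaximal) (hJ : J.IsMaximal)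
    {x : X.M} (h0 : x ≠ 0) (hx : ∀ r ∈ I, G.emb r • x = 0) (hx' : ∀ r ∈ J, G.emb r • x = 0) :
    I = J :=
  le_antisymm (fun _ hr => gwa_kill_mem X hJ h0 hx' (hx _ hr))
    (fun _ hr => gwa_kill_mem X hI h0 hx (hx' _ hr))

/-- the weight ideal in degree `i` for `C_{lam,n}` -/
def gwaW (σ : R ≃ₐ[ℂ] R) (lam : Ideal R) (i : ℤ) : Ideal R :=
  Ideal.comap (σ ^ i : R ≃ₐ[ℂ] R) lam

theorem gwa_memW {lam : Ideal R} {i : ℤ} {r : R} : r ∈ gwaW σ lam i ↔ (σ ^ i) r ∈ lam := Iff.rfl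

theorem gwaW_max {lam : Ideal R} (hl : lam.IsMaximal) (i : ℤ) : (gwaW σ lam i).IsMaximal :=
  Ideal.comap_isMaximal_of_surjective _ (σ ^ i : R ≃ₐ[ℂ] R).surjective

/-- All degrees are killed by the weight ideals. -/
def GwaWt (S : GradedMod G) (lam : Ideal R) (n : ℤ) : Prop :=
  ∀ i, ∀ s ∈ S.deg i, ∀ r ∈ gwaW σ lam (i + n), G.emb r • s = 0

/-- The largest graded submodule on which the weights are right. -/
def gwaWtSub (X : GradedMod G) (lam : Ideal R) (n : ℤ) : Submodule G.A X.M where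
  carrier := {m | ∀ i, ∀ r ∈ gwaW σ lam (i + n), G.emb r • X.pr i m = 0}
  add_mem' := by
    intro a b ha hb i r hr
    rw [map_add, smul_add, ha i r hr, hb i r hr, add_zero]
  zero_mem' := by intro i r hr; rw [map_zero, smul_zero]
  smul_mem' := by
    intro a m hm
    induction a using gwa_alg_ind with
    | h0 => intro i r hr; rw [zero_smul, map_zero, smul_zero]
    | hadd a b ha hb => 
      intro i r hr
      rw [add_smul, map_add, smul_add, ha i r hr, hb i r hr, add_zero]
    | hh k a ha =>
      intro i r hr
      rw [gwa_pr_smul' X ha, smul_smul, gwa_comm ha, mul_smul, hm, smul_zero]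
      rw [gwa_memW, ← AlgEquiv.mul_apply, ← zpow_add]
      rw [gwa_memW] at hr
      convert hr using 3
      ring

theorem gwa_wtSub_graded (X : GradedMod G) (lam : Ideal R) (n : ℤ) :
    IsGradedSub X (gwaWtSub X lam n) := by
  rw [gwa_gsub_iff]
  intro m hm j i r hr
  by_cases h : j = i
  · subst h; rw [gwa_pr_same X (gwa_pr_mem X _ _)]; exact hm _ r hr
  · rw [gwa_pr_ne X (gwa_pr_mem X _ _) h, smul_zero]

theorem gwa_wtSub_mem (X : GradedMod G) (lam : Ideal R) (n : ℤ) {i : ℤ} {x : X.M}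
    (hx : x ∈ X.deg i) (h : ∀ r ∈ gwaW σ lam (i + n), G.emb r • x = 0) :
    x ∈ gwaWtSub X lam n := by
  intro j r hr
  by_cases hij : i = j
  · subst hij; rw [gwa_pr_same X hx]; exact h r hr
  · rw [gwa_pr_ne X hx hij, smul_zero]

theorem gwa_wt_of_top (X : GradedMod G) (lam : Ideal R) (n : ℤ) (h : gwaWtSub X lam n = ⊤) :
    GwaWt X lam n := by
  intro i s hs r hr
  have h1 : s ∈ gwaWtSub X lam n := h ▸ Submodule.mem_top
  have := h1 i r hr
  rwa [gwa_pr_same X hs] at this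

theorem gwa_wt_simple (S : GradedMod G) (hS : IsSimpleGr S) (lam : Ideal R) (n : ℤ) {i : ℤ}
    {x : S.M} (hx : x ∈ S.deg i) (h0 : x ≠ 0)
    (h : ∀ r ∈ gwaW σ lam (i + n), G.emb r • x = 0) : GwaWt S lam n := by
  apply gwa_wt_of_top
  refine (hS.2 _ (gwa_wtSub_graded S lam n)).resolve_left fun hbot => h0 ?_
  have := gwa_wtSub_mem S lam n hx h
  rw [hbot] at this
  exact (Submodule.mem_bot _).1 this

/-- homogeneous lift in a subquotient -/
theorem gwa_subq_lift {X Y : GradedMod G} (Q : Submodule G.A X.M) (hQ : IsGradedSub X Q)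
    (φ : Q →ₗ[G.A] Y.M) (hφ : Function.Surjective φ)
    (hd : ∀ (i : ℤ) (q : Q), (q : X.M) ∈ X.deg i → φ q ∈ Y.deg i) {i : ℤ} {y : Y.M}
    (hy : y ∈ Y.deg i) : ∃ q : Q, (q : X.M) ∈ X.deg i ∧ φ q = y := by
  obtain ⟨q, rfl⟩ := hφ y
  refine ⟨(SubGM X Q hQ).pr i q, gwa_pr_mem (SubGM X Q hQ) i q, ?_⟩
  have := gwa_map_pr (X := SubGM X Q hQ) (Y := Y) φ.toAddMonoidHom 0 (by
    intro i m hm; rw [add_zero]; exact hd i m hm) i q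
  rw [add_zero] at this
  refine this.trans (gwa_pr_same Y hy)

theorem gwa_wt_subq {X Y : GradedMod G} (h : IsSubquotient X Y) {lam : Ideal R} {n : ℤ}
    (hX : GwaWt X lam n) : GwaWt Y lam n := by
  obtain ⟨Q, P, hQ, hP, hPQ, φ, hφ, hker, hd⟩ := h
  intro i s hs r hr
  obtain ⟨q, hq, rfl⟩ := gwa_subq_lift Q hQ φ hφ hd hs
  rw [← map_smul]
  have : G.emb r • q = 0 := Subtype.ext (hX i q hq r hr)
  rw [this, map_zero]

theorem gwa_simple_hom (S : GradedMod G) (hS : IsSimpleGr S) : ∃ i, ∃ s ∈ S.deg i, s ≠ 0 := by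
  obtain ⟨m, hm⟩ := hS.1
  by_contra! h
  exact hm (gwa_ext_pr S fun i => h i _ (gwa_pr_mem S i m))

theorem gwa_simple_span (S : GradedMod G) (hS : IsSimpleGr S) {i : ℤ} {s : S.M} (hs : s ∈ S.deg i)
    (h0 : s ≠ 0) : Submodule.span G.A {s} = ⊤ :=
  (hS.2 _ (gwa_span_graded S hs)).resolve_left fun h => h0 (by
    simpa using h)

end GwaAlg


noncomputable section GwaSimple

variable {R : Type} [CommRing R] [Algebra ℂ R] {σ : R ≃ₐ[ℂ] R} {v : R} {G : GWA R σ v}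

theorem gwa_sub_wd (S : GradedMod G) (hS : IsSimpleGr S) (X : GradedMod G) {I : Ideal R}
    (hI : I.IsMaximal) {i : ℤ} {s : S.M} (hs : s ∈ S.deg i) (hs0 : s ≠ 0)
    (hsI : ∀ r ∈ I, G.emb r • s = 0) {x : X.M} (hx : x ∈ X.deg i) (hx0 : x ≠ 0)
    (hxI : ∀ r ∈ I, G.emb r • x = 0) (a : G.A) (ha : a • x = 0) : a • s = 0 := by
  apply gwa_ext_pr S
  intro j
  rw [gwa_pr_smul S hs]
  have hax : gwaPr G (j - i) a • x = 0 := by rw [← gwa_pr_smul X hx, ha, map_zero]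
  set b := gwaPr G (j - i) a with hb
  have hbm : b ∈ G.deg (j - i) := gwa_apr_mem _ _
  by_contra hne
  have hbs : b • s ∈ S.deg j := by
    have := S.smul_mem hbm hs
    rwa [sub_add_cancel] at this
  have htop := gwa_simple_span S hS hbs hne
  have hmem : s ∈ Submodule.span G.A {b • s} := htop ▸ Submodule.mem_top
  obtain ⟨c, hc⟩ := Submodule.mem_span_singleton.1 hmem
  have h1 := congrArg (S.pr i) hc
  rw [gwa_pr_smul S hbs, gwa_pr_same S hs, smul_smul] at h1
  have hm : gwaPr G (i - j) c * b ∈ G.deg 0 := by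
    have := G.mul_mem (gwa_apr_mem (i - j) c) hbm
    rwa [show i - j + (j - i) = 0 by ring] at this
  obtain ⟨r, hr⟩ := gwa_deg0 hm
  have h2 : r - 1 ∈ I := by
    apply gwa_kill_mem S hI hs0 hsI
    rw [map_sub, sub_smul, ← hr, h1, map_one, one_smul, sub_self]
  have h3 := hxI _ h2
  rw [map_sub, sub_smul, ← hr, mul_smul, hax, smul_zero, map_one, one_smul, zero_sub,
    neg_eq_zero] at h3
  exact hx0 h3

theorem gwa_lemma_sub (S : GradedMod G) (hS : IsSimpleGr S) (X : GradedMod G) {I : Ideal R}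
    (hI : I.IsMaximal) {i : ℤ} {s : S.M} (hs : s ∈ S.deg i) (hs0 : s ≠ 0)
    (hsI : ∀ r ∈ I, G.emb r • s = 0) {x : X.M} (hx : x ∈ X.deg i) (hx0 : x ≠ 0)
    (hxI : ∀ r ∈ I, G.emb r • x = 0) : IsSubquotient X S := by
  have hwd : ∀ a : G.A, a • x = 0 → (RingHom.id G.A) a • s = 0 :=
    gwa_sub_wd S hS X hI hs hs0 hsI hx hx0 hxI
  let p : X.M →ₗ.[G.A] S.M := LinearPMap.mkSpanSingleton' x s hwd
  have hp : ∀ (a : G.A) (ha : a • x ∈ p.domain), p.toFun ⟨a • x, ha⟩ = a • s := fun a ha =>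
    LinearPMap.mkSpanSingleton'_apply x s hwd a ha
  have hmem : ∀ a : G.A, a • x ∈ p.domain := fun a =>
    Submodule.smul_mem _ _ (Submodule.mem_span_singleton_self x)
  refine ⟨p.domain, (LinearMap.ker p.toFun).map p.domain.subtype, gwa_span_graded X hx, ?_,
    Submodule.map_subtype_le _ _, p.toFun, ?_, ?_, ?_⟩
  · rw [gwa_gsub_iff]
    rintro m ⟨⟨q, hq⟩, hk, rfl⟩ j
    obtain ⟨a, rfl⟩ := Submodule.mem_span_singleton.1 hq
    refine ⟨⟨gwaPr G (j - i) a • x, hmem _⟩, ?_, (gwa_pr_smul X hx j a).symm⟩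
    change p.toFun _ = 0
    have hk' : p.toFun ⟨a • x, hq⟩ = 0 := hk
    rw [hp] at hk' ⊢
    rw [← gwa_pr_smul S hs, hk', map_zero]
  · intro y
    have hy : y ∈ Submodule.span G.A {s} := gwa_simple_span S hS hs hs0 ▸ Submodule.mem_top
    obtain ⟨a, rfl⟩ := Submodule.mem_span_singleton.1 hy
    exact ⟨⟨a • x, hmem a⟩, hp a _⟩
  · intro q
    constructor
    · intro h; exact ⟨q, h, rfl⟩
    · rintro ⟨q', h, h'⟩
      have : q' = q := Subtype.ext h'
      rw [← this]; exact h
  · rintro j ⟨q, hq⟩ hqd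
    obtain ⟨a, rfl⟩ := Submodule.mem_span_singleton.1 hq
    have h1 : a • x = gwaPr G (j - i) a • x := by
      rw [← gwa_pr_smul X hx, gwa_pr_same X hqd]
    have h2 : p.toFun ⟨a • x, hq⟩ = gwaPr G (j - i) a • s := by
      rw [← hp _ (hmem _)]
      exact congrArg p.toFun (Subtype.ext h1)
    rw [h2]
    have := S.smul_mem (gwa_apr_mem (j - i) a) hs
    rwa [sub_add_cancel] at this

theorem gwa_lemma_top (X : GradedMod G) {I : Ideal R}
    (hI : I.IsMaximal) {i : ℤ} {x : X.M} (hx : x ∈ X.deg i) (hx0 : x ≠ 0)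
    (hxI : ∀ r ∈ I, G.emb r • x = 0) : ∃ S : GradedMod G, IsSubquotient X S ∧ IsSimpleGr S ∧
      ∃ s ∈ S.deg i, s ≠ 0 ∧ ∀ r ∈ I, G.emb r • s = 0 := by
  let Q : Submodule G.A X.M := Submodule.span G.A {x}
  have hQ : IsGradedSub X Q := gwa_span_graded X hx
  let P : Submodule G.A X.M :=
    { carrier := {y | ∀ a : G.A, X.pr i (a • y) = 0}
      add_mem' := by intro y z hy hz a; rw [smul_add, map_add, hy, hz, add_zero]
      zero_mem' := by intro a; rw [smul_zero, map_zero]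
      smul_mem' := by intro b y hy a; rw [smul_smul]; exact hy _ }
  have hP : ∀ y ∈ P, ∀ j, X.pr j y ∈ P := by
    intro y hy j a
    rw [gwa_pr_smul X (gwa_pr_mem X j y)]
    have := hy (gwaPr G (i - j) a)
    rw [gwa_pr_smul' X (gwa_apr_mem _ _)] at this
    rwa [sub_sub_cancel] at this
  let Y := SubGM X Q hQ
  let ι : Y.M →ₗ[G.A] X.M := Q.subtype
  have hι : ∀ y : Y.M, ι y ∈ Q := fun y => Subtype.property (p := fun x => x ∈ Q) y
  have hιinj : ∀ y z : Y.M, ι y = ι z → y = z := fun y z h => Subtype.ext h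
  let P' : Submodule G.A Y.M := P.comap ι
  have hpr : ∀ (j : ℤ) (q : Y.M), ι (Y.pr j q) = X.pr j (ι q) := by
    intro j q
    have := gwa_map_pr (X := Y) (Y := X) ι.toAddMonoidHom 0 (by
      intro i m hm; rw [add_zero]; exact hm) j q
    rw [add_zero] at this
    exact this
  have hP' : IsGradedSub Y P' := by
    rw [gwa_gsub_iff]
    intro q hq j
    change ι (Y.pr j q) ∈ P
    rw [hpr]
    exact hP _ hq j
  let x' : Y.M := (⟨x, Submodule.mem_span_singleton_self x⟩ : Q)
  have hx' : ι x' = x := rfl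
  have hxP : x ∉ P := by
    intro h
    have := h 1
    rw [one_smul, gwa_pr_same X hx] at this
    exact hx0 this
  refine ⟨gwaQuot Y P' hP', ⟨Q, P ⊓ Q, hQ, ?_, inf_le_right, P'.mkQ, P'.mkQ_surjective, ?_, ?_⟩,
    ⟨?_, ?_⟩, P'.mkQ x', ?_, ?_, ?_⟩
  · rw [gwa_gsub_iff]
    intro m hm j
    exact ⟨hP _ hm.1 j, (gwa_gsub_iff X Q).1 hQ _ hm.2 j⟩
  · intro q
    refine (Submodule.Quotient.mk_eq_zero P').trans ?_
    exact ⟨fun h => ⟨h, q.2⟩, fun h => h.1⟩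
  · intro j q hq
    exact ⟨q, hq, rfl⟩
  · exact ⟨P'.mkQ x', fun h => hxP ((Submodule.Quotient.mk_eq_zero P').1 h)⟩
  · intro N hN
    by_cases hN' : N ≤ ⊥
    · left; exact le_bot_iff.1 hN'
    right
    obtain ⟨m, hm, hm0⟩ := Set.not_subset.1 hN'
    obtain ⟨y, rfl⟩ := P'.mkQ_surjective m
    have hyP : ι y ∉ P := fun h => hm0 ((Submodule.Quotient.mk_eq_zero P').2 h)
    obtain ⟨a, ha⟩ : ∃ a : G.A, X.pr i (a • ι y) ≠ 0 := by
      by_contra! h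
      exact hyP h
    let z : Y.M := Y.pr i (a • y)
    have hzval : ι z = X.pr i (a • ι y) := by rw [hpr, map_smul]
    have hz : P'.mkQ z ∈ N := by
      have h1 : P'.mkQ (a • y) ∈ N := by
        rw [map_smul]; exact N.smul_mem a hm
      have h2 := (gwa_gsub_iff (gwaQuot Y P' hP') N).1 hN _ h1 i
      have h3 := gwa_map_pr (X := Y) (Y := gwaQuot Y P' hP') P'.mkQ.toAddMonoidHom 0 (by
        intro i m hm; rw [add_zero]; exact ⟨m, hm, rfl⟩) i (a • y)
      rw [add_zero] at h3
      exact (congrArg (fun w => w ∈ N) h3).mpr h2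
    obtain ⟨b, hb⟩ := Submodule.mem_span_singleton.1 (hι z)
    have h1 : X.pr i (ι z) = ι z := by
      rw [hzval, gwa_pr_same X (gwa_pr_mem X _ _)]
    rw [← hb, gwa_pr_smul X hx, sub_self] at h1
    obtain ⟨r, hr⟩ := gwa_deg0 (gwa_apr_mem (G := G) 0 b)
    rw [hr, hb] at h1
    have hrI : r ∉ I := by
      intro h
      rw [hxI r h] at h1
      rw [← hzval, ← h1] at ha
      exact ha rfl
    obtain ⟨s, hs⟩ := gwa_kill_unit X hI hxI hrI
    rw [h1] at hs
    have hxN : P'.mkQ x' ∈ N := by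
      have : x' = G.emb s • z := hιinj _ _ (by rw [map_smul, hs]; exact hx')
      rw [this]
      exact N.smul_mem (G.emb s) hz
    rw [eq_top_iff]
    intro w _
    obtain ⟨⟨w, hw⟩, rfl⟩ := P'.mkQ_surjective w
    obtain ⟨c, rfl⟩ := Submodule.mem_span_singleton.1 hw
    exact N.smul_mem c hxN
  · exact ⟨x', hx, rfl⟩
  · exact fun h => hxP ((Submodule.Quotient.mk_eq_zero P').1 h)
  · intro r hr
    have h1 : G.emb r • x' = 0 := hιinj _ _ (by rw [map_smul, hx', hxI r hr, map_zero])
    have h2 : G.emb r • P'.mkQ x' = 0 := by rw [← map_smul, h1, map_zero]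
    exact h2

/-! ### Standard modules -/

theorem gwa_span_gr0 (lam : Ideal R) (m : G.A)
    (hm : m ∈ Submodule.span G.A (G.emb '' (lam : Set R))) (j : ℤ) :
    gwaPr G j m ∈ Submodule.span G.A (G.emb '' (lam : Set R)) := by
  have : ∀ b : G.A, gwaPr G j (b * m) ∈ Submodule.span G.A (G.emb '' (lam : Set R)) := by
    induction hm using Submodule.span_induction with
    | mem x hx =>
      intro b
      obtain ⟨r, hr, rfl⟩ := hx
      have h1 : gwaPr G j (b * G.emb r) = gwaPr G (j - 0) b * G.emb r :=
        gwa_pr_smul (gwaReg G) (G.emb_mem r) j b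
      rw [h1]
      exact Submodule.smul_mem _ _ (Submodule.subset_span ⟨r, hr, rfl⟩)
    | zero => intro b; rw [mul_zero, map_zero]; exact zero_mem _
    | add x y _ _ hx hy => intro b; rw [mul_add, map_add]; exact add_mem (hx b) (hy b)
    | smul a x _ hx => intro b; rw [smul_eq_mul, ← mul_assoc]; exact hx _
  have h1 := this 1
  rw [one_mul] at h1
  exact h1

theorem gwa_span_gr (lam : Ideal R) :
    IsGradedSub (gwaReg G) (Submodule.span G.A (G.emb '' (lam : Set R)) : Submodule G.A G.A) :=
  (gwa_gsub_iff (gwaReg G) _).2 (fun m hm j => gwa_span_gr0 lam m hm j)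

theorem gwa_std_exists (G : GWA R σ v) (lam : Ideal R) : ∃ X : GradedMod G, IsStdMod G lam X := by
  let P : Submodule G.A G.A := Submodule.span G.A (G.emb '' (lam : Set R))
  have h1 : ∀ w : G.A, w • P.mkQ (1 : G.A) = P.mkQ w := by
    intro w; rw [← map_smul, smul_eq_mul, mul_one]
  have h2 : ∀ w : G.A ⧸ P, w ∈ Submodule.span G.A {P.mkQ (1 : G.A)} := by
    intro w
    obtain ⟨w, rfl⟩ := P.mkQ_surjective w
    exact Submodule.mem_span_singleton.2 ⟨w, h1 w⟩
  have h3 : ∀ a : G.A, a • P.mkQ (1 : G.A) = 0 ↔ a ∈ P := by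
    intro a
    rw [h1]
    exact Submodule.Quotient.mk_eq_zero P
  exact ⟨gwaQuot (gwaReg G) P (gwa_span_gr lam), P.mkQ (1 : G.A), ⟨(1 : G.A), gwa_one_mem G, rfl⟩,
    eq_top_iff.2 (fun w _ => h2 w), h3⟩

theorem gwa_std_coef (lam : Ideal R) {y : G.A}
    (hy : y ∈ Submodule.span G.A (G.emb '' (lam : Set R))) (k : ℤ) :
    ∃ r ∈ lam, gwaPr G k y = gwaT G k * G.emb r := by
  have : ∀ b : G.A, ∃ r ∈ lam, gwaPr G k (b * y) = gwaT G k * G.emb r := by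
    induction hy using Submodule.span_induction with
    | mem x hx =>
      intro b
      obtain ⟨r, hr, rfl⟩ := hx
      have h1 : gwaPr G k (b * G.emb r) = gwaPr G (k - 0) b * G.emb r :=
        gwa_pr_smul (gwaReg G) (G.emb_mem r) k b
      obtain ⟨s, hs⟩ := gwaT_span (gwa_apr_mem (k - 0) b)
      refine ⟨s * r, lam.mul_mem_left s hr, ?_⟩
      rw [h1, hs, sub_zero, map_mul, mul_assoc]
    | zero => intro b; exact ⟨0, zero_mem _, by simp⟩
    | add x y _ _ hx hy =>
      intro b
      obtain ⟨r, hr, h⟩ := hx b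
      obtain ⟨r', hr', h'⟩ := hy b
      exact ⟨r + r', add_mem hr hr', by rw [mul_add, map_add, h, h', map_add, mul_add]⟩
    | smul a x _ hx => intro b; rw [smul_eq_mul, ← mul_assoc]; exact hx _
  have h1 := this 1
  rw [one_mul] at h1
  exact h1

theorem gwa_std_wt (lam : Ideal R) (X : GradedMod G) (hX : IsStdMod G lam X) : GwaWt X lam 0 := by
  obtain ⟨x, hx, hsp, hann⟩ := hX
  apply gwa_wt_of_top
  rw [eq_top_iff, ← hsp, Submodule.span_singleton_le_iff_mem]
  apply gwa_wtSub_mem X lam 0 hx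
  intro r hr
  rw [hann]
  exact Submodule.subset_span ⟨r, by simpa [gwa_memW] using hr, rfl⟩

theorem gwa_std_ne (lam : Ideal R) (hl : lam ≠ ⊤) (X : GradedMod G) (hX : IsStdMod G lam X)
    (k : ℤ) : ∃ y ∈ X.deg k, y ≠ 0 := by
  obtain ⟨x, hx, hsp, hann⟩ := hX
  refine ⟨gwaT G k • x, ?_, ?_⟩
  · have := X.smul_mem (gwaT_mem k) hx
    rwa [add_zero] at this
  · intro h
    rw [hann] at h
    obtain ⟨r, hr, h1⟩ := gwa_std_coef lam h k
    rw [gwa_apr_same (gwaT_mem k)] at h1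
    have h2 : gwaT G k * G.emb (1 - r) = 0 := by
      rw [map_sub, mul_sub, ← h1, map_one, mul_one, sub_self]
    have h3 := gwaT_inj h2
    rw [sub_eq_zero] at h3
    exact hl ((Ideal.eq_top_iff_one _).2 (h3 ▸ hr))

theorem gwa_inCat_iff (lam : Ideal R) (hl : lam.IsMaximal) (n : ℤ) (M : GradedMod G) :
    InCat G lam n M ↔ IsArtinianGr M ∧ ∀ S, IsSubquotient M S → IsSimpleGr S → GwaWt S lam n := by
  refine and_congr_right fun _ => forall_congr' fun S => forall_congr' fun hSM =>
    forall_congr' fun hS => ?_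
  constructor
  · rintro ⟨X, hX, S', hS', -, f, hf⟩ i s hs r hr
    apply hf.1
    rw [map_smul, map_zero]
    exact gwa_wt_subq hS' (gwa_std_wt lam X hX) _ _ (f.map_deg i s hs) r (by rwa [add_zero])
  · intro hwt
    obtain ⟨X, hX⟩ := gwa_std_exists G lam
    obtain ⟨i, s, hs, hs0⟩ := gwa_simple_hom S hS
    obtain ⟨x, hx, hx0⟩ := gwa_std_ne lam hl.ne_top X hX (i + n)
    have hS2 : IsSimpleGr (gwaShift S (-n)) :=
      ⟨hS.1, fun N hN => hS.2 N ((gwa_shift_gsub S (-n) N).1 hN)⟩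
    refine ⟨X, hX, gwaShift S (-n), ?_, hS2, ⟨⟨LinearMap.id, ?_⟩, Function.bijective_id⟩⟩
    · refine gwa_lemma_sub (gwaShift S (-n)) hS2 X (gwaW_max hl (i + n)) (i := i + n) (s := s)
        ?_ hs0 (hwt i s hs) hx hx0 ?_
      · change s ∈ S.deg (i + n + -n)
        rwa [add_neg_cancel_right]
      · intro r hr
        exact gwa_std_wt lam X hX _ x hx r (by rwa [add_zero])
    · intro j m hm
      change m ∈ S.deg (j + n + -n)
      rwa [add_neg_cancel_right]

theorem gwa_simple_art (S : GradedMod G) (hS : IsSimpleGr S) : IsArtinianGr S := by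
  intro f hf hle
  by_cases h : ∃ n, f n = ⊥
  · obtain ⟨n, hn⟩ := h
    refine ⟨n, fun m hm => ?_⟩
    have := antitone_nat_of_succ_le hle hm
    rw [hn] at this ⊢
    exact le_bot_iff.1 this
  · push Not at h
    exact ⟨0, fun m _ => by
      rw [(hS.2 _ (hf m)).resolve_left (h m), (hS.2 _ (hf 0)).resolve_left (h 0)]⟩

theorem gwa_part1 (lam mu : Ideal R) (hl : lam.IsMaximal) (hm : mu.IsMaximal) (n m : ℤ) :
    (∀ M : GradedMod G, InCat G lam n M ↔ InCat G mu m M) ↔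
        mu = Ideal.map ((σ ^ (m - n) : R ≃ₐ[ℂ] R)).toAlgHom.toRingHom lam := by
  have hmap : Ideal.map ((σ ^ (m - n) : R ≃ₐ[ℂ] R)).toAlgHom.toRingHom lam =
      gwaW σ lam (n - m) := by
    have h1 := Ideal.map_comap_of_equiv (I := lam) ((σ ^ (m - n) : R ≃ₐ[ℂ] R)).toRingEquiv
    have h2 : ((σ ^ (m - n) : R ≃ₐ[ℂ] R)).symm = σ ^ (n - m) := by
      change (σ ^ (m - n))⁻¹ = _
      rw [← zpow_neg, neg_sub]
    rw [gwaW, ← h2]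
    exact h1
  rw [hmap]
  constructor
  · intro h
    obtain ⟨X, hX⟩ := gwa_std_exists G lam
    obtain ⟨x, hx, hx0⟩ := gwa_std_ne lam hl.ne_top X hX n
    have hX' : ∃ x' ∈ (gwaShift X n).deg 0, x' ≠ 0 ∧ ∀ r ∈ gwaW σ lam n, G.emb r • x' = 0 :=
      ⟨x, by change x ∈ X.deg (0 + n); rwa [zero_add], hx0, fun r hr =>
        gwa_std_wt lam X hX n x hx r (by rwa [add_zero])⟩
    obtain ⟨x', hx', hx0', hk⟩ := hX'
    obtain ⟨S, -, hS, s, hs, hs0, hsk⟩ := gwa_lemma_top (gwaShift X n) (gwaW_max hl n) hx' hx0' hk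
    have hwt : GwaWt S lam n := gwa_wt_simple S hS lam n hs hs0 (by rwa [zero_add])
    have hin : InCat G lam n S := (gwa_inCat_iff lam hl n S).2
      ⟨gwa_simple_art S hS, fun S' h _ => gwa_wt_subq h hwt⟩
    have hin' := (gwa_inCat_iff mu hm m S).1 ((h S).1 hin)
    have hself : IsSubquotient S S := gwa_lemma_sub S hS S (gwaW_max hl n) hs hs0 hsk hs hs0 hsk
    have hwt' := hin'.2 S hself hS 0 s hs
    rw [zero_add] at hwt'
    have heq := gwa_kill_eq S (gwaW_max hm m) (gwaW_max hl n) hs0 hwt' hsk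
    ext r
    have h3 := SetLike.ext_iff.1 heq ((σ ^ (-m)) r)
    rw [gwa_memW, gwa_memW, ← AlgEquiv.mul_apply, ← AlgEquiv.mul_apply, ← zpow_add, ← zpow_add,
      add_neg_cancel, zpow_zero, ← sub_eq_add_neg] at h3
    exact h3
  · rintro rfl M
    have hW : ∀ i, gwaW σ (gwaW σ lam (n - m)) (i + m) = gwaW σ lam (i + n) := by
      intro i
      ext r
      rw [gwa_memW, gwa_memW, gwa_memW, ← AlgEquiv.mul_apply, ← zpow_add,
        show n - m + (i + m) = i + n by ring]
    rw [gwa_inCat_iff lam hl, gwa_inCat_iff _ hm]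
    unfold GwaWt
    simp only [hW]

end GwaSimple


noncomputable section GwaPartTwo

variable {R : Type} [CommRing R] [Algebra ℂ R] {σ : R ≃ₐ[ℂ] R} {v : R} {G : GWA R σ v}

theorem gwaW_pow (lam : Ideal R) (i : ℤ) (n : ℕ) :
    gwaW σ (lam ^ n) i = (gwaW σ lam i) ^ n := by
  have h : ∀ J : Ideal R, gwaW σ J i = Ideal.map ((σ ^ i : R ≃ₐ[ℂ] R).symm : R ≃+* R) J := by
    intro J
    exact (Ideal.map_symm ((σ ^ i : R ≃ₐ[ℂ] R) : R ≃+* R)).symm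
  rw [h, h, Ideal.map_pow]

theorem gwaW_add (lam : Ideal R) (i j : ℤ) : gwaW σ (gwaW σ lam i) j = gwaW σ lam (j + i) := by
  ext r
  rw [gwa_memW, gwa_memW, gwa_memW, ← AlgEquiv.mul_apply, ← zpow_add, add_comm]

theorem gwaW_zero (lam : Ideal R) : gwaW σ lam 0 = lam := by
  ext r
  rw [gwa_memW, zpow_zero]; rfl

/-- `x` is torsion for `I`. -/
def GwaTo (X : GradedMod G) (I : Ideal R) (x : X.M) : Prop := ∃ n : ℕ, ∀ r ∈ I ^ n, G.emb r • x = 0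

theorem gwa_to_zero (X : GradedMod G) (I : Ideal R) : GwaTo X I (0 : X.M) :=
  ⟨0, fun r _ => smul_zero _⟩

theorem gwa_to_add (X : GradedMod G) (I : Ideal R) {x y : X.M} (hx : GwaTo X I x)
    (hy : GwaTo X I y) : GwaTo X I (x + y) := by
  obtain ⟨n, hn⟩ := hx
  obtain ⟨m, hm⟩ := hy
  refine ⟨n + m, fun r hr => ?_⟩
  rw [smul_add, hn r (Ideal.pow_le_pow_right (Nat.le_add_right _ _) hr),
    hm r (Ideal.pow_le_pow_right (Nat.le_add_left _ _) hr), add_zero]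

theorem gwa_emb_comm (X : GradedMod G) (r s : R) (x : X.M) :
    G.emb r • G.emb s • x = G.emb s • G.emb r • x := by
  rw [smul_smul, smul_smul, ← map_mul, ← map_mul, mul_comm]

theorem gwa_to_smul (X : GradedMod G) (I : Ideal R) {x : X.M} (hx : GwaTo X I x) (s : R) :
    GwaTo X I (G.emb s • x) := by
  obtain ⟨n, hn⟩ := hx
  exact ⟨n, fun r hr => by rw [gwa_emb_comm, hn r hr, smul_zero]⟩

theorem gwa_to_bottom (X : GradedMod G) (I : Ideal R) {x : X.M} (hx : GwaTo X I x) (h0 : x ≠ 0) :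
    ∃ r, G.emb r • x ≠ 0 ∧ ∀ q ∈ I, G.emb q • G.emb r • x = 0 := by
  classical
  have hx' : ∃ n : ℕ, ∀ r ∈ I ^ n, G.emb r • x = 0 := hx
  have hmin := fun m => Nat.find_min (m := m) hx'
  have hsp := Nat.find_spec hx'
  generalize Nat.find hx' = n at hmin hsp
  cases n with
  | zero =>
    exact absurd (by simpa using hsp 1 (by simp)) h0
  | succ n =>
    have h1 := hmin n (Nat.lt_succ_self n)
    push Not at h1
    obtain ⟨r, hr, hr0⟩ := h1
    refine ⟨r, hr0, fun q hq => ?_⟩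
    rw [smul_smul, ← map_mul, mul_comm]
    exact hsp _ (by rw [pow_succ]; exact Ideal.mul_mem_mul hr hq)

/-- the `lam`-primary part -/
def gwaN (X : GradedMod G) (lam : Ideal R) : Submodule G.A X.M where
  carrier := {m | ∀ i, GwaTo X (gwaW σ lam i) (X.pr i m)}
  add_mem' := by
    intro a b ha hb i
    rw [map_add]; exact gwa_to_add X _ (ha i) (hb i)
  zero_mem' := by intro i; rw [map_zero]; exact gwa_to_zero X _
  smul_mem' := by
    intro a m hm
    induction a using gwa_alg_ind with
    | h0 => intro i; rw [zero_smul, map_zero]; exact gwa_to_zero X _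
    | hadd a b ha hb =>
      intro i
      rw [add_smul, map_add]; exact gwa_to_add X _ (ha i) (hb i)
    | hh k a ha =>
      intro i
      obtain ⟨n, hn⟩ := hm (i - k)
      refine ⟨n, fun r hr => ?_⟩
      rw [gwa_pr_smul' X ha, smul_smul, gwa_comm ha, mul_smul, hn, smul_zero]
      rw [← gwaW_pow] at hr ⊢
      rw [gwa_memW, ← AlgEquiv.mul_apply, ← zpow_add]
      rw [gwa_memW] at hr
      convert hr using 3
      ring

theorem gwaN_iff (X : GradedMod G) (lam : Ideal R) (m : X.M) :
    m ∈ gwaN X lam ↔ ∀ i, GwaTo X (gwaW σ lam i) (X.pr i m) := Iff.rfl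

theorem gwaN_graded (X : GradedMod G) (lam : Ideal R) : IsGradedSub X (gwaN X lam) := by
  rw [gwa_gsub_iff]
  intro m hm j
  rw [gwaN_iff]
  intro i
  by_cases h : j = i
  · subst h; rw [gwa_pr_same X (gwa_pr_mem X _ _)]; exact hm _
  · rw [gwa_pr_ne X (gwa_pr_mem X _ _) h]; exact gwa_to_zero X _

theorem gwaN_mem (X : GradedMod G) (lam : Ideal R) {i : ℤ} {x : X.M} (hx : x ∈ X.deg i)
    (h : GwaTo X (gwaW σ lam i) x) : x ∈ gwaN X lam := by
  rw [gwaN_iff]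
  intro j
  by_cases hij : i = j
  · subst hij; rw [gwa_pr_same X hx]; exact h
  · rw [gwa_pr_ne X hx hij]; exact gwa_to_zero X _

theorem gwaN_sup {κ : Type} (L : κ → Ideal R) (hL : ∀ k, (L k).IsMaximal) (X : GradedMod G)
    {t : X.M} (ht : t ∈ ⨆ k, gwaN X (L k)) (i : ℤ) (mu : Ideal R) (hmu : mu.IsMaximal) :
    ∃ b, b ∉ mu ∧ ((∀ k, gwaW σ (L k) i ≠ mu) → G.emb b • X.pr i t = 0) ∧
      GwaTo X mu (G.emb b • X.pr i t) := by
  induction ht using Submodule.iSup_induction' with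
  | mem k x hx =>
    by_cases h : gwaW σ (L k) i = mu
    · refine ⟨1, fun h1 => hmu.ne_top ((Ideal.eq_top_iff_one _).2 h1), fun h' => (h' k h).elim, ?_⟩
      apply gwa_to_smul
      exact h ▸ hx i
    · obtain ⟨b, hb, hbm⟩ : ∃ b ∈ gwaW σ (L k) i, b ∉ mu := by
        by_contra! hc
        exact h ((gwaW_max (hL k) i).eq_of_le hmu.ne_top hc)
      obtain ⟨n, hn⟩ := hx i
      have h0 := hn _ (Ideal.pow_mem_pow hb n)
      refine ⟨b ^ n, fun h' => hbm (hmu.isPrime.mem_of_pow_mem _ h'), fun _ => h0, ?_⟩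
      rw [h0]; exact gwa_to_zero X _
  | zero =>
    refine ⟨1, fun h1 => hmu.ne_top ((Ideal.eq_top_iff_one _).2 h1), fun h' => ?_, ?_⟩
    · rw [map_zero, smul_zero]
    · rw [map_zero, smul_zero]; exact gwa_to_zero X _
  | add x y _ _ hx hy =>
    obtain ⟨b, hb, hb0, hbt⟩ := hx
    obtain ⟨c, hc, hc0, hct⟩ := hy
    have e : G.emb (b * c) • X.pr i (x + y)
        = G.emb c • (G.emb b • X.pr i x) + G.emb b • (G.emb c • X.pr i y) := by
      rw [map_add, smul_add, map_mul, mul_smul, mul_smul, gwa_emb_comm X b c]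
    refine ⟨b * c, fun h => (hmu.isPrime.mem_or_mem h).elim hb hc, fun h' => ?_, ?_⟩
    · rw [e, hb0 h', hc0 h', smul_zero, smul_zero, add_zero]
    · rw [e]
      exact gwa_to_add X _ (gwa_to_smul X _ hbt c) (gwa_to_smul X _ hct b)

theorem gwa_sup_graded {κ : Type} (X : GradedMod G) (N : κ → Submodule G.A X.M)
    (hN : ∀ k, IsGradedSub X (N k)) {t : X.M} (ht : t ∈ ⨆ k, N k) (i : ℤ) :
    X.pr i t ∈ ⨆ k, N k := by
  induction ht using Submodule.iSup_induction' with
  | mem k x hx => exact Submodule.mem_iSup_of_mem k ((gwa_gsub_iff X _).1 (hN k) x hx i)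
  | zero => rw [map_zero]; exact zero_mem _
  | add x y _ _ hx hy => rw [map_add]; exact add_mem hx hy

theorem gwa_art_wf (X : GradedMod G) (hX : IsArtinianGr X) :
    WellFounded (fun P Q : {N : Submodule G.A X.M // IsGradedSub X N} => P < Q) := by
  rw [RelEmbedding.wellFounded_iff_isEmpty]
  refine ⟨fun f => ?_⟩
  obtain ⟨n, hn⟩ := hX (fun n => (f n).1) (fun n => (f n).2) (fun n =>
    le_of_lt (f.map_rel_iff.2 (Nat.lt_succ_self n)))
  have h1 : f (n + 1) < f n := f.map_rel_iff.2 (Nat.lt_succ_self n)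
  exact h1.ne (Subtype.ext (hn (n + 1) (Nat.le_succ n)))

theorem gwa_part2_top [IsNoetherianRing R] (X : GradedMod G) (hX : IsArtinianGr X) :
    (⨆ k : MaximalSpectrum R, gwaN X k.asIdeal) = ⊤ := by
  classical
  set T := ⨆ k : MaximalSpectrum R, gwaN X k.asIdeal with hT
  by_contra hne
  have h1 : ∃ i, ∃ y ∈ X.deg i, y ∉ T := by
    by_contra! hc
    refine hne (eq_top_iff.2 fun m _ => ?_)
    obtain ⟨s, hs⟩ := gwa_pr_sum X m
    rw [hs]
    exact Submodule.sum_mem _ fun i _ => hc i _ (gwa_pr_mem X i m)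
  obtain ⟨i, y0, hy0, hy0T⟩ := h1
  obtain ⟨⟨P, hP⟩, ⟨y, hy, hyT, hPy⟩, hmin⟩ := (gwa_art_wf X hX).has_min
    {P | ∃ y ∈ X.deg i, y ∉ T ∧ P.1 = Submodule.span G.A {y}}
    ⟨⟨_, gwa_span_graded X hy0⟩, y0, hy0, hy0T, rfl⟩
  have hmin' : ∀ z ∈ X.deg i, z ∉ T → z ∈ Submodule.span G.A {y} →
      y ∈ Submodule.span G.A {z} := by
    intro z hz hzT hzy
    by_contra hc
    refine hmin ⟨Submodule.span G.A {z}, gwa_span_graded X hz⟩ ⟨z, hz, hzT, rfl⟩ ?_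
    have : Submodule.span G.A {z} < P := by
      have hPy' : P = Submodule.span G.A {y} := hPy
      rw [hPy']
      refine lt_of_le_of_ne ((Submodule.span_singleton_le_iff_mem _ _).2 hzy) fun h => hc ?_
      rw [h]; exact Submodule.mem_span_singleton_self y
    exact this
  let mu : Ideal R :=
    { carrier := {r | G.emb r • y ∈ T}
      add_mem' := by
        intro a b (ha : G.emb a • y ∈ T) (hb : G.emb b • y ∈ T)
        show G.emb (a + b) • y ∈ T
        rw [map_add, add_smul]; exact add_mem ha hb
      zero_mem' := by
        show G.emb 0 • y ∈ T
        rw [map_zero, zero_smul]; exact zero_mem _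
      smul_mem' := by
        intro c a (ha : G.emb a • y ∈ T)
        show G.emb (c * a) • y ∈ T
        rw [map_mul, mul_smul]; exact T.smul_mem _ ha }
  have hmem : ∀ r, r ∈ mu ↔ G.emb r • y ∈ T := fun r => Iff.rfl
  have hmu : mu.IsMaximal := by
    rw [Ideal.isMaximal_iff]
    refine ⟨?_, fun J r hJ hr hrJ => ?_⟩
    · rw [hmem, map_one, one_smul]; exact hyT
    · rw [hmem] at hr
      have h2 := hmin' _ (gwa_emb_smul_mem X hy r) hr
        (Submodule.smul_mem _ _ (Submodule.mem_span_singleton_self y))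
      obtain ⟨a, ha⟩ := Submodule.mem_span_singleton.1 h2
      have h3 := congrArg (X.pr i) ha
      rw [gwa_pr_smul X (gwa_emb_smul_mem X hy r), sub_self, gwa_pr_same X hy] at h3
      obtain ⟨s, hs⟩ := gwa_deg0 (gwa_apr_mem (G := G) 0 a)
      rw [hs] at h3
      have h4 : (1 - s * r) ∈ mu := by
        rw [hmem, map_sub, sub_smul, map_one, one_smul, map_mul, mul_smul, h3, sub_self]
        exact zero_mem _
      have h5 := add_mem (hJ h4) (J.mul_mem_left s hrJ)
      rwa [sub_add_cancel] at h5
  obtain ⟨S, hS⟩ := (IsNoetherian.noetherian mu : mu.FG)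
  have hSm : ∀ g ∈ S, g ∈ mu := fun g hg => by rw [← hS]; exact Submodule.subset_span hg
  have hF : ∀ g : R, ∃ b, b ∉ mu ∧ (g ∈ mu → GwaTo X mu (G.emb b • G.emb g • y)) := by
    intro g
    by_cases hg : g ∈ mu
    · obtain ⟨b, hb, -, hbt⟩ := gwaN_sup (fun k : MaximalSpectrum R => k.asIdeal)
        (fun k => k.isMaximal) X ((hmem g).1 hg) i mu hmu
      rw [gwa_pr_same X (gwa_emb_smul_mem X hy g)] at hbt
      exact ⟨b, hb, fun _ => hbt⟩
    · exact ⟨1, fun h1 => hmu.ne_top ((Ideal.eq_top_iff_one _).2 h1), fun h => (hg h).elim⟩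
  choose b hb hbt using hF
  let B := ∏ g ∈ S, b g
  have hB : B ∉ mu := by
    intro h
    obtain ⟨g, _, hg⟩ := (hmu.isPrime.prod_mem_iff).1 h
    exact hb g hg
  have hBt : ∀ g ∈ S, GwaTo X mu (G.emb g • G.emb B • y) := by
    intro g hg
    have : B = (∏ g ∈ S.erase g, b g) * b g := (Finset.prod_erase_mul S b hg).symm
    rw [this, gwa_emb_comm, map_mul, mul_smul]
    exact gwa_to_smul X _ (hbt g (hSm g hg)) _
  have hN : ∃ n : ℕ, ∀ g ∈ S, ∀ q ∈ mu ^ n, G.emb q • G.emb g • G.emb B • y = 0 := by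
    choose! f hf using hBt
    refine ⟨S.sup f, fun g hg q hq => hf g hg q ?_⟩
    exact Ideal.pow_le_pow_right (Finset.le_sup hg) hq
  obtain ⟨n, hn⟩ := hN
  have hn' : ∀ g ∈ mu, ∀ q ∈ mu ^ n, G.emb q • G.emb g • G.emb B • y = 0 := by
    intro g hg q hq
    rw [← hS] at hg
    induction hg using Submodule.span_induction with
    | mem g hg => exact hn g hg q hq
    | zero => rw [map_zero, zero_smul, smul_zero]
    | add g h _ _ hg hh => rw [map_add, add_smul, smul_add, hg, hh, add_zero]
    | smul c g _ hg =>
      rw [smul_eq_mul, map_mul, mul_smul, gwa_emb_comm X q c, hg, smul_zero]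
  have hto : GwaTo X mu (G.emb B • y) := by
    refine ⟨n + 1, fun r hr => ?_⟩
    rw [pow_succ] at hr
    refine Submodule.mul_induction_on (C := fun r => G.emb r • G.emb B • y = 0) hr ?_ ?_
    · intro q hq g hg
      rw [map_mul, mul_smul]; exact hn' g hg q hq
    · intro x y hx hy
      rw [map_add, add_smul, hx, hy, add_zero]
  apply hB
  rw [hmem, hT]
  refine Submodule.mem_iSup_of_mem ⟨gwaW σ mu (-i), gwaW_max hmu _⟩ ?_
  refine gwaN_mem X _ (gwa_emb_smul_mem X hy B) ?_
  rw [gwaW_add, add_neg_cancel, gwaW_zero]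
  exact hto

theorem gwa_part2_disj (X : GradedMod G) (k : MaximalSpectrum R) :
    Disjoint (gwaN X k.asIdeal) (⨆ j, ⨆ _ : j ≠ k, gwaN X j.asIdeal) := by
  rw [Submodule.disjoint_def]
  intro y hy hy'
  rw [iSup_subtype'] at hy'
  apply gwa_ext_pr
  intro i
  have hmax := gwaW_max (σ := σ) k.isMaximal i
  obtain ⟨b, hb, hb0, -⟩ := gwaN_sup (fun j : {j : MaximalSpectrum R // j ≠ k} => j.1.asIdeal)
    (fun j => j.1.isMaximal) X hy' i _ hmax
  have hb0 := hb0 (by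
    intro j hj
    apply j.2
    apply MaximalSpectrum.ext
    have := congrArg (fun I => gwaW σ I (-i)) hj
    simpa only [gwaW_add, neg_add_cancel, gwaW_zero] using this)
  by_contra hne
  obtain ⟨r, hr0, hr⟩ := gwa_to_bottom X _ (hy i) hne
  obtain ⟨s, hs⟩ := gwa_kill_unit X hmax hr hb
  rw [gwa_emb_comm X b r, hb0, smul_zero, smul_zero] at hs
  exact hr0 hs.symm

theorem gwa_sub_art (X : GradedMod G) (hX : IsArtinianGr X) (N : Submodule G.A X.M)
    (hN : IsGradedSub X N) : IsArtinianGr (SubGM X N hN) := by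
  intro f hf hmono
  let Y := SubGM X N hN
  let ι : Y.M →ₗ[G.A] X.M := N.subtype
  have hι : Function.Injective ι := N.injective_subtype
  let g : ℕ → Submodule G.A Y.M := f
  obtain ⟨n, hn⟩ := hX (fun n => (g n).map ι) (fun n => by
    rw [gwa_gsub_iff]
    rintro _ ⟨m, hm, rfl⟩ i
    refine ⟨Y.pr i m, (gwa_gsub_iff Y _).1 (hf n) m hm i, ?_⟩
    have h3 := gwa_map_pr (X := Y) (Y := X) ι.toAddMonoidHom 0 (by
        intro i m hm; rw [add_zero]; exact hm) i m
    rw [add_zero] at h3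
    exact h3) (fun n => Submodule.map_mono (hmono n))
  refine ⟨n, fun m hm => ?_⟩
  exact Submodule.map_injective_of_injective hι (hn m hm)

theorem gwa_to_simple (X : GradedMod G) (lam : Ideal R) (hX : ∀ i, ∀ x ∈ X.deg i, GwaTo X (gwaW σ lam i) x)
    (S : GradedMod G) (hS : IsSubquotient X S) (hsi : IsSimpleGr S) : GwaWt S lam 0 := by
  obtain ⟨Q, P, hQ, hP, hPQ, φ, hφ, hker, hd⟩ := hS
  obtain ⟨i, s, hs, hs0⟩ := gwa_simple_hom S hsi
  obtain ⟨q, hq, hqs⟩ := gwa_subq_lift Q hQ φ hφ hd hs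
  obtain ⟨n, hn⟩ := hX i q hq
  have ht : GwaTo S (gwaW σ lam i) s := by
    refine ⟨n, fun r hr => ?_⟩
    rw [← hqs, ← map_smul]
    have : G.emb r • q = 0 := Subtype.ext (hn r hr)
    rw [this, map_zero]
  obtain ⟨r, hr0, hr⟩ := gwa_to_bottom S _ ht hs0
  exact gwa_wt_simple S hsi lam 0 (gwa_emb_smul_mem S hs r) hr0 (by rw [add_zero]; exact hr)

theorem gwa_part2_cat (X : GradedMod G) (hX : IsArtinianGr X) (k : MaximalSpectrum R) :
    InCat G k.asIdeal 0 (SubGM X (gwaN X k.asIdeal) (gwaN_graded X k.asIdeal)) := by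
  rw [gwa_inCat_iff _ k.isMaximal]
  refine ⟨gwa_sub_art X hX _ _, fun S hS hsi => gwa_to_simple _ k.asIdeal ?_ S hS hsi⟩
  let Y := SubGM X (gwaN X k.asIdeal) (gwaN_graded X k.asIdeal)
  let ι : Y.M →ₗ[G.A] X.M := (gwaN X k.asIdeal).subtype
  have hι : Function.Injective ι := (gwaN X k.asIdeal).injective_subtype
  intro i (y : Y.M) (hy : ι y ∈ X.deg i)
  have hm : ι y ∈ gwaN X k.asIdeal := Subtype.property (p := fun x => x ∈ gwaN X k.asIdeal) y
  obtain ⟨n, hn⟩ := hm i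
  rw [gwa_pr_same X hy] at hn
  refine ⟨n, fun r hr => hι ?_⟩
  rw [map_smul, map_zero]
  exact hn r hr

theorem gwa_part2 [IsNoetherianRing R] (M : GradedMod G) (hM : IsArtinianGr M) :
      ∃ (ι : Type) (N : ι → Submodule G.A M.M) (hgr : ∀ i, IsGradedSub M (N i)),
        (⨆ i, N i) = ⊤ ∧
        (∀ i : ι, Disjoint (N i) (⨆ j, ⨆ _ : j ≠ i, N j)) ∧
        (∀ i : ι, ∃ (lam : Ideal R) (n : ℤ), lam.IsMaximal ∧
          InCat G lam n (SubGM M (N i) (hgr i))) :=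
  ⟨MaximalSpectrum R, fun k => gwaN M k.asIdeal, fun k => gwaN_graded M k.asIdeal,
    gwa_part2_top M hM, gwa_part2_disj M, fun k => ⟨k.asIdeal, 0, k.isMaximal,
      gwa_part2_cat M hM k⟩⟩

/-- torsion in the category -/
theorem gwa_cat_tors [IsNoetherianRing R] (lam : Ideal R) (hl : lam.IsMaximal) (n : ℤ)
    (M : GradedMod G) (hM : InCat G lam n M) :
    ∀ i, ∀ x ∈ M.deg i, GwaTo M (gwaW σ lam (i + n)) x := by
  rw [gwa_inCat_iff _ hl] at hM
  have htop := gwa_part2_top M hM.1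
  have key : ∀ k : MaximalSpectrum R, gwaN M k.asIdeal ≤ gwaN M (gwaW σ lam n) := by
    intro k y hy i
    by_cases h0 : M.pr i y = 0
    · rw [h0]; exact gwa_to_zero M _
    have hmax := gwaW_max (σ := σ) k.isMaximal i
    obtain ⟨r, hr0, hr⟩ := gwa_to_bottom M _ (hy i) h0
    obtain ⟨S, hS, hsi, s, hs, hs0, hsk⟩ := gwa_lemma_top M hmax
      (gwa_emb_smul_mem M (gwa_pr_mem M i y) r) hr0 hr
    have h2 := hM.2 S hS hsi i s hs
    have h3 := gwa_kill_eq S hmax (gwaW_max hl (i + n)) hs0 hsk h2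
    rw [gwaW_add, ← h3]
    exact hy i
  have h1 : gwaN M (gwaW σ lam n) = ⊤ := by
    rw [eq_top_iff, ← htop]
    exact iSup_le key
  intro i x hx
  have h2 : x ∈ gwaN M (gwaW σ lam n) := by rw [h1]; exact Submodule.mem_top
  have h3 := h2 i
  rwa [gwaW_add, gwa_pr_same M hx] at h3

end GwaPartTwo


noncomputable section GwaBij

variable {R : Type} [CommRing R] [Algebra ℂ R] {σ : R ≃ₐ[ℂ] R} {v : R} {G : GWA R σ v}

/-- products of conjugates of `v` avoid primes off the orbit -/
def GwaOff (σ : R ≃ₐ[ℂ] R) (v r : R) : Prop :=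
  ∀ P : Ideal R, P.IsPrime → (∀ j : ℤ, (σ ^ j) v ∉ P) → r ∉ P

theorem gwa_off_tmtp (n : ℕ) : ∃ r, G.tm ^ n * G.tp ^ n = G.emb r ∧ GwaOff σ v r := by
  induction n with
  | zero => exact ⟨1, by simp, fun P hP _ h => hP.ne_top ((Ideal.eq_top_iff_one _).2 h)⟩
  | succ n ih =>
    obtain ⟨r, hr, ho⟩ := ih
    refine ⟨r * (σ ^ ((n : ℤ) + 1)) v, ?_, fun P hP hv h => ?_⟩
    · have h1 : G.tm ^ (n + 1) * G.tp ^ (n + 1) = G.tm ^ n * ((G.tm * G.tp) * G.tp ^ n) := by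
        rw [pow_succ, pow_succ', mul_assoc, mul_assoc]
      rw [h1, G.rel3, gwa_comm (gwa_tp_mem n), ← mul_assoc, hr, ← map_mul, zpow_add, zpow_one,
        AlgEquiv.mul_apply]
    · exact (hP.mem_or_mem h).elim (ho P hP hv) (hv _)

theorem gwa_off_tptm (n : ℕ) : ∃ r, G.tp ^ n * G.tm ^ n = G.emb r ∧ GwaOff σ v r := by
  induction n with
  | zero => exact ⟨1, by simp, fun P hP _ h => hP.ne_top ((Ideal.eq_top_iff_one _).2 h)⟩
  | succ n ih =>
    obtain ⟨r, hr, ho⟩ := ih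
    refine ⟨r * (σ ^ (-(n : ℤ))) v, ?_, fun P hP hv h => ?_⟩
    · have h1 : G.tp ^ (n + 1) * G.tm ^ (n + 1) = G.tp ^ n * ((G.tp * G.tm) * G.tm ^ n) := by
        rw [pow_succ, pow_succ' G.tm, mul_assoc, mul_assoc]
      rw [h1, G.rel4, gwa_comm (gwa_tm_mem n), ← mul_assoc, hr, ← map_mul]
    · exact (hP.mem_or_mem h).elim (ho P hP hv) (hv _)

theorem gwa_off_T (k : ℤ) : ∃ r, gwaT G (-k) * gwaT G k = G.emb r ∧ GwaOff σ v r := by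
  obtain ⟨n, rfl | rfl⟩ := k.eq_nat_or_neg
  · rw [gwaT_neg, gwaT_pos]; exact gwa_off_tmtp n
  · rw [gwaT_neg, neg_neg, gwaT_pos]; exact gwa_off_tptm n

theorem gwa_to_unit (X : GradedMod G) {I : Ideal R} (hI : I.IsMaximal) {x : X.M}
    (hx : GwaTo X I x) {r : R} (hr : r ∉ I) : ∃ s, G.emb r • G.emb s • x = x := by
  obtain ⟨n, hn⟩ := hx
  have h1 : IsCoprime (Ideal.span {r}) (I ^ n) := by
    apply IsCoprime.pow_right
    rw [Ideal.isCoprime_iff_sup_eq, sup_comm]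
    exact hI.1.2 _ (lt_of_le_of_ne le_sup_left (fun h => hr (by
      rw [h]; exact Ideal.mem_sup_right (Ideal.mem_span_singleton_self r))))
  obtain ⟨a, ha, b, hb, hab⟩ := Ideal.isCoprime_iff_exists.1 h1
  obtain ⟨s, rfl⟩ := Ideal.mem_span_singleton'.1 ha
  refine ⟨s, ?_⟩
  have h2 := congrArg (fun z => G.emb z • x) hab
  simp only [map_add, add_smul, hn b hb, add_zero, map_one, one_smul] at h2
  rw [smul_smul, ← map_mul, mul_comm]
  exact h2

theorem gwa_bij_inj (lam : Ideal R) (hl : lam.IsMaximal) (hv : ∀ k : ℤ, (σ ^ k) v ∉ lam) (n : ℤ)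
    (M : GradedMod G) (hM : ∀ i, ∀ x ∈ M.deg i, GwaTo M (gwaW σ lam (i + n)) x)
    {i k : ℤ} {x : M.M} (hx : x ∈ M.deg i) (h : gwaT G k • x = 0) : x = 0 := by
  obtain ⟨r, hr, ho⟩ := gwa_off_T (G := G) k
  have hmax := gwaW_max (σ := σ) hl (i + n)
  have hrI : r ∉ gwaW σ lam (i + n) := by
    refine ho _ hmax.isPrime fun j hj => ?_
    rw [gwa_memW, ← AlgEquiv.mul_apply, ← zpow_add] at hj
    exact hv _ hj
  obtain ⟨s, hs⟩ := gwa_to_unit M hmax (hM i x hx) hrI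
  rw [gwa_emb_comm, ← hr, mul_smul, h, smul_zero, smul_zero] at hs
  exact hs.symm

theorem gwa_bij_surj (lam : Ideal R) (hl : lam.IsMaximal) (hv : ∀ k : ℤ, (σ ^ k) v ∉ lam) (n : ℤ)
    (M : GradedMod G) (hM : ∀ i, ∀ x ∈ M.deg i, GwaTo M (gwaW σ lam (i + n)) x)
    {i k : ℤ} {y : M.M} (hy : y ∈ M.deg (k + i)) : ∃ x ∈ M.deg i, gwaT G k • x = y := by
  obtain ⟨r, hr, ho⟩ := gwa_off_T (G := G) (-k)
  rw [neg_neg] at hr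
  have hmax := gwaW_max (σ := σ) hl (k + i + n)
  have hrI : r ∉ gwaW σ lam (k + i + n) := by
    refine ho _ hmax.isPrime fun j hj => ?_
    rw [gwa_memW, ← AlgEquiv.mul_apply, ← zpow_add] at hj
    exact hv _ hj
  obtain ⟨s, hs⟩ := gwa_to_unit M hmax (hM _ y hy) hrI
  refine ⟨gwaT G (-k) • G.emb s • y, ?_, ?_⟩
  · have := M.smul_mem (gwaT_mem (G := G) (-k)) (gwa_emb_smul_mem M hy s)
    rwa [neg_add_cancel_left] at this
  · rw [smul_smul, hr, hs]

end GwaBij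


section GwaDom

variable {R : Type} [CommRing R]

/-- kernel at the front of a chain -/
def gwaK {V : Type} [AddCommGroup V] [Module R V] : (q : ℕ) → (X : ℕ → ModuleCat.{0} R) →
    (d : ∀ i, X i →ₗ[R] X (i + 1)) → (g : X q →ₗ[R] V) → Submodule R (X 0)
  | 0, _, _, g => LinearMap.ker g
  | _ + 1, _, d, _ => LinearMap.ker (d 0)

/-- exactness of `X 0 → ⋯ → X q → V → 0` (except at the front). -/
def GwaEx {V : Type} [AddCommGroup V] [Module R V] : (q : ℕ) → (X : ℕ → ModuleCat.{0} R) →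
    (d : ∀ i, X i →ₗ[R] X (i + 1)) → (g : X q →ₗ[R] V) → Prop
  | 0, _, _, g => Function.Surjective g
  | q + 1, X, d, g => LinearMap.range (d 0) = gwaK q (fun i => X (i + 1)) (fun i => d (i + 1)) g ∧
      GwaEx q (fun i => X (i + 1)) (fun i => d (i + 1)) g

theorem gwa_ex_iff {V : Type} [AddCommGroup V] [Module R V] : ∀ (q : ℕ) (X : ℕ → ModuleCat.{0} R)
    (d : ∀ i, X i →ₗ[R] X (i + 1)) (g : X (q + 1) →ₗ[R] V), GwaEx (q + 1) X d g ↔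
      ((∀ i < q, Function.Exact (d i) (d (i + 1))) ∧ Function.Exact (d q) g ∧
        Function.Surjective g) := by
  intro q
  induction q with
  | zero =>
    intro X d g
    constructor
    · rintro ⟨h1, h2⟩
      exact ⟨fun i hi => absurd hi (Nat.not_lt_zero i), LinearMap.exact_iff.2 h1.symm, h2⟩
    · rintro ⟨-, h1, h2⟩
      exact ⟨(LinearMap.exact_iff.1 h1).symm, h2⟩
  | succ q ih =>
    intro X d g
    have h := ih (fun i => X (i + 1)) (fun i => d (i + 1)) g
    constructor
    · rintro ⟨h1, h2⟩
      obtain ⟨h3, h4, h5⟩ := h.1 h2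
      refine ⟨fun i hi => ?_, h4, h5⟩
      cases i with
      | zero => exact LinearMap.exact_iff.2 h1.symm
      | succ i => exact h3 i (by omega)
    · rintro ⟨h1, h2, h3⟩
      exact ⟨(LinearMap.exact_iff.1 (h1 0 (by omega))).symm,
        h.2 ⟨fun i hi => h1 (i + 1) (by omega), h2, h3⟩⟩

/-- prepend a module to a family -/
def gwaCons (P : ModuleCat.{0} R) (F : ℕ → ModuleCat.{0} R) : ℕ → ModuleCat.{0} R
  | 0 => P
  | i + 1 => F i

def gwaConsD (P : ModuleCat.{0} R) (F : ℕ → ModuleCat.{0} R) (e : ∀ i, F i →ₗ[R] F (i + 1))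
    (f : P →ₗ[R] F 0) : ∀ i, gwaCons P F i →ₗ[R] gwaCons P F (i + 1)
  | 0 => f
  | i + 1 => e i

theorem gwa_K_map {V : Type} [AddCommGroup V] [Module R V] : ∀ (q : ℕ) (X F : ℕ → ModuleCat.{0} R)
    (d : ∀ i, X i →ₗ[R] X (i + 1)) (g : X q →ₗ[R] V)
    (e : ∀ i, F i →ₗ[R] F (i + 1)) (h : F q →ₗ[R] V) (φ : ∀ i, F i →ₗ[R] X i)
    (_ : g ∘ₗ φ q = h) (_ : ∀ i < q, d i ∘ₗ φ i = φ (i + 1) ∘ₗ e i)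
    (x : F 0) (_ : x ∈ gwaK q F e h), φ 0 x ∈ gwaK q X d g := by
  intro q X F d g e h φ h1 h2 x hx
  cases q with
  | zero =>
    have hx' : h x = 0 := hx
    show g (φ 0 x) = 0
    rw [← hx', ← h1]; rfl
  | succ q =>
    have hx' : e 0 x = 0 := hx
    show d 0 (φ 0 x) = 0
    have := LinearMap.congr_fun (h2 0 (Nat.succ_pos q)) x
    refine this.trans ?_
    show φ 1 (e 0 x) = 0
    rw [hx', map_zero]

/-- any surjection from a projective -/
theorem gwa_free_cover (K : Type) [AddCommGroup K] [Module R K] : ∃ (P : ModuleCat.{0} R)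
    (_ : Module.Projective R P) (π : P →ₗ[R] K), Function.Surjective π :=
  ⟨ModuleCat.of R (K →₀ R), inferInstanceAs (Module.Projective R (K →₀ R)),
    Finsupp.linearCombination R id, Finsupp.linearCombination_id_surjective R K⟩

theorem gwa_dom {V W : Type} [AddCommGroup V] [Module R V] [AddCommGroup W] [Module R W] :
    ∀ (q : ℕ) (X : ℕ → ModuleCat.{0} R)
    (d : ∀ i, X i →ₗ[R] X (i + 1)) (g : X q →ₗ[R] V) (_ : GwaEx q X d g),
    ∃ (F : ℕ → ModuleCat.{0} R) (e : ∀ i, F i →ₗ[R] F (i + 1)) (h : F q →ₗ[R] V)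
      (φ : ∀ i, F i →ₗ[R] X i), GwaEx q F e h ∧ g ∘ₗ φ q = h ∧
      (∀ i < q, d i ∘ₗ φ i = φ (i + 1) ∘ₗ e i) ∧
      ∀ k, GwaEV R V W (k + 1 + q + 1) → GwaEV R (gwaK q F e h) W (k + 1) := by
  intro q
  induction q with
  | zero =>
    intro X d g hg
    obtain ⟨P, hP, π, hπ⟩ := gwa_free_cover (R := R) V
    obtain ⟨ψ, hψ⟩ := Module.projective_lifting_property g π hg
    refine ⟨gwaCons P X, gwaConsD P X (fun i => d i) 0, π, fun i => match i with
      | 0 => ψ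
      | i + 1 => 0, hπ, hψ, fun i hi => absurd hi (Nat.not_lt_zero i), fun k hk => ?_⟩
    have : Module.Projective R P := hP
    exact gwa_ev3 (LinearMap.ker π).subtype π (LinearMap.ker π).injective_subtype
      (LinearMap.exact_subtype_ker_map π) hπ hk (gwa_ev4 k)
  | succ q ih =>
    intro X d g hg
    obtain ⟨hg1, hg2⟩ := hg
    obtain ⟨F, e, h, φ, hex, hgφ, hcomm, hev⟩ := ih (fun i => X (i + 1)) (fun i => d (i + 1)) g hg2
    obtain ⟨P, hP, π, hπ⟩ := gwa_free_cover (R := R) (gwaK q F e h)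
    have : Module.Projective R P := hP
    let K := gwaK q F e h
    let f : P →ₗ[R] F 0 := K.subtype ∘ₗ π
    have hmem : ∀ x, φ 0 (f x) ∈ LinearMap.range (d 0) := by
      intro x
      rw [hg1]
      exact gwa_K_map q (fun i => X (i + 1)) F (fun i => d (i + 1)) g e h φ hgφ hcomm _ (π x).2
    obtain ⟨ψ, hψ⟩ := Module.projective_lifting_property (d 0).rangeRestrict
      ((φ 0 ∘ₗ f).codRestrict (LinearMap.range (d 0)) hmem) (d 0).surjective_rangeRestrict
    have hrange : LinearMap.range f = K := by
      rw [LinearMap.range_comp, LinearMap.range_eq_top.2 hπ, Submodule.map_top,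
        Submodule.range_subtype]
    refine ⟨gwaCons P F, gwaConsD P F e f, h, fun i => match i with
      | 0 => ψ
      | i + 1 => φ i, ⟨hrange, hex⟩, hgφ, ?_, ?_⟩
    · intro i hi
      cases i with
      | zero =>
        refine LinearMap.ext fun x => ?_
        exact congrArg Subtype.val (LinearMap.congr_fun hψ x)
      | succ i => exact hcomm i (by omega)
    · intro k hk
      have h1 : GwaEV R K W (k + 1 + 1) := hev (k + 1) (by
        have e : k + 1 + 1 + q + 1 = k + 1 + (q + 1) + 1 := by omega
        rw [e]; exact hk)
      have h2 : GwaEV R (LinearMap.ker π) W (k + 1) :=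
        gwa_ev3 (LinearMap.ker π).subtype π (LinearMap.ker π).injective_subtype
          (LinearMap.exact_subtype_ker_map π) hπ h1 (gwa_ev4 k)
      have h3 : LinearMap.ker f = LinearMap.ker π := by
        rw [LinearMap.ker_comp, Submodule.ker_subtype]; rfl
      show GwaEV R (LinearMap.ker f) W (k + 1)
      rw [h3]
      exact h2

/-- the final output -/
theorem gwa_dom_final {V W : Type} [AddCommGroup V] [Module R V] [AddCommGroup W] [Module R W]
    (q : ℕ) (X : ℕ → ModuleCat.{0} R) (d : ∀ i, X i →ₗ[R] X (i + 1)) (g : X (q + 1) →ₗ[R] V)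
    (f : W →ₗ[R] X 0) (hf : Function.Injective f) (hfd : Function.Exact f (d 0))
    (hex : GwaEx (q + 1) X d g) (hev : GwaEV R V W (q + 2)) :
    ∃ (F : ℕ → ModuleCat.{0} R) (e : ∀ i, F i →ₗ[R] F (i + 1)) (h : F (q + 1) →ₗ[R] V)
      (φ : ∀ i, F i →ₗ[R] X i), GwaEx (q + 1) F e h ∧ Function.Injective (e 0) ∧
      g ∘ₗ φ (q + 1) = h ∧ (∀ i ≤ q, d i ∘ₗ φ i = φ (i + 1) ∘ₗ e i) := by
  obtain ⟨hg1, hg2⟩ := hex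
  obtain ⟨F, e, h, φ, hex, hgφ, hcomm, hevv⟩ :=
    gwa_dom (W := W) q (fun i => X (i + 1)) (fun i => d (i + 1)) g hg2
  let K := gwaK q F e h
  have hK : GwaEV R K W 1 := hevv 0 (by
    have e : 0 + 1 + q + 1 = q + 2 := by omega
    rw [e]; exact hev)
  have hmem : ∀ x : K, ∃ y, d 0 y = (φ 0 ∘ₗ K.subtype) x := by
    intro x
    have : φ 0 (K.subtype x) ∈ LinearMap.range (d 0) := by
      rw [hg1]
      exact gwa_K_map q (fun i => X (i + 1)) F (fun i => d (i + 1)) g e h φ hgφ hcomm _ x.2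
    exact this
  obtain ⟨ψ, hψ⟩ := gwa_ev6 f (d 0) hf hfd hK (φ 0 ∘ₗ K.subtype) hmem
  refine ⟨gwaCons (ModuleCat.of R K) F, gwaConsD (ModuleCat.of R K) F e K.subtype, h,
    fun i => match i with
      | 0 => ψ
      | i + 1 => φ i, ⟨K.range_subtype, hex⟩, K.injective_subtype, hgφ, ?_⟩
  intro i hi
  cases i with
  | zero => exact hψ
  | succ i => exact hcomm i (by omega)

end GwaDom


noncomputable section GwaIndSec
open TensorProduct

variable {R : Type} [CommRing R] [Algebra ℂ R] {σ : R ≃ₐ[ℂ] R} {v : R} {G : GWA R σ v}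

/-- the algebra as a left module over itself and a right module over `R`. -/
def GwaAR (G : GWA R σ v) : Type := G.A

instance gwaARacg (G : GWA R σ v) : AddCommGroup (GwaAR G) := inferInstanceAs (AddCommGroup G.A)
instance gwaARmodA (G : GWA R σ v) : Module G.A (GwaAR G) := inferInstanceAs (Module G.A G.A)

def gwaOf (G : GWA R σ v) : G.A →ₗ[G.A] GwaAR G := LinearMap.id (R := G.A) (M := G.A)
def gwaTo (G : GWA R σ v) : GwaAR G →ₗ[G.A] G.A := LinearMap.id (R := G.A) (M := G.A)

theorem gwa_of_to (a : GwaAR G) : gwaOf G (gwaTo G a) = a := rfl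
theorem gwa_to_of (a : G.A) : gwaTo G (gwaOf G a) = a := rfl

instance gwaARmodR (G : GWA R σ v) : Module R (GwaAR G) where
  smul r a := gwaOf G (gwaTo G a * G.emb r)
  one_smul a := by
    show gwaOf G (gwaTo G a * G.emb 1) = a
    rw [map_one, mul_one]; rfl
  mul_smul r s a := by
    show gwaOf G (gwaTo G a * G.emb (r * s)) = gwaOf G (gwaTo G a * G.emb s * G.emb r)
    rw [mul_assoc, ← map_mul, mul_comm]
  smul_zero r := by
    show gwaOf G (gwaTo G 0 * G.emb r) = 0
    rw [map_zero, zero_mul, map_zero]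
  smul_add r a b := by
    show gwaOf G (gwaTo G (a + b) * G.emb r) = gwaOf G (gwaTo G a * G.emb r) + gwaOf G (gwaTo G b * G.emb r)
    rw [map_add, add_mul, map_add]
  add_smul r s a := by
    show gwaOf G (gwaTo G a * G.emb (r + s)) = gwaOf G (gwaTo G a * G.emb r) + gwaOf G (gwaTo G a * G.emb s)
    rw [map_add, mul_add, map_add]
  zero_smul a := by
    show gwaOf G (gwaTo G a * G.emb 0) = 0
    rw [map_zero, mul_zero, map_zero]

theorem gwa_AR_smul (r : R) (a : G.A) : r • gwaOf G a = gwaOf G (a * G.emb r) := rfl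

instance gwaARcomm (G : GWA R σ v) : SMulCommClass R G.A (GwaAR G) where
  smul_comm r a b := by
    show gwaOf G ((a * gwaTo G b) * G.emb r) = gwaOf G (a * (gwaTo G b * G.emb r))
    rw [mul_assoc]

theorem gwa_AR_li (c : ℤ) : LinearIndependent R (fun i : ℤ => gwaOf G (gwaT G (i - c))) := by
  rw [linearIndependent_iff']
  intro s g hg i hi
  have h1 : ∑ i ∈ s, gwaT G (i - c) * G.emb (g i) = 0 := hg
  have h2 : ∑ k ∈ s.map (Equiv.subRight c).toEmbedding, gwaT G k * G.emb (g (k + c)) = 0 := by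
    rw [Finset.sum_map, ← h1]
    refine Finset.sum_congr rfl fun j _ => ?_
    simp
  have h3 := G.indep _ (fun k => gwaT G k * G.emb (g (k + c))) (fun k => by
    have := G.mul_mem (gwaT_mem (G := G) k) (G.emb_mem (g (k + c)))
    rwa [add_zero] at this) h2 (i - c) (by
      simp only [Finset.mem_map]
      exact ⟨i, hi, rfl⟩)
  have h4 := gwaT_inj h3
  rwa [sub_add_cancel] at h4

theorem gwa_AR_span (c : ℤ) :
    ⊤ ≤ Submodule.span R (Set.range (fun i : ℤ => gwaOf G (gwaT G (i - c)))) := by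
  intro a _
  obtain ⟨s, hs⟩ := gwa_apr_sum (gwaTo G a)
  have h1 : a = ∑ i ∈ s, gwaOf G (gwaPr G i (gwaTo G a)) := by
    rw [← map_sum, ← hs]; rfl
  rw [h1]
  refine Submodule.sum_mem _ fun i _ => ?_
  obtain ⟨r, hr⟩ := gwaT_span (gwa_apr_mem (G := G) i (gwaTo G a))
  rw [hr, ← gwa_AR_smul]
  refine Submodule.smul_mem _ _ (Submodule.subset_span ⟨i + c, ?_⟩)
  show gwaOf G (gwaT G (i + c - c)) = _
  rw [add_sub_cancel_right]

def gwaBasis (G : GWA R σ v) (c : ℤ) : Module.Basis ℤ R (GwaAR G) :=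
  Module.Basis.mk (gwa_AR_li c) (gwa_AR_span c)

theorem gwaBasis_apply (c i : ℤ) : gwaBasis G c i = gwaOf G (gwaT G (i - c)) := by
  rw [gwaBasis, Module.Basis.mk_apply]

instance gwaFlat (G : GWA R σ v) : Module.Flat R (GwaAR G) := by
  have : Module.Free R (GwaAR G) := Module.Free.of_basis (gwaBasis G 0)
  infer_instance

section Ind
variable (V : Type) [AddCommGroup V] [Module R V]

/-- basic element in degree `i` -/
def gwaB (G : GWA R σ v) (c i : ℤ) : V →ₗ[R] GwaAR G ⊗[R] V :=
  TensorProduct.mk R (GwaAR G) V (gwaOf G (gwaT G (i - c)))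

theorem gwa_ind_smul_mem (c : ℤ) {i j : ℤ} {a : G.A} (ha : a ∈ G.deg i) (x : V) :
    ∃ y, a • gwaB V G c j x = gwaB V G c (i + j) y := by
  have h1 := G.mul_mem ha (gwaT_mem (G := G) (j - c))
  obtain ⟨r, hr⟩ := gwaT_span h1
  refine ⟨r • x, ?_⟩
  show (a • gwaOf G (gwaT G (j - c))) ⊗ₜ[R] x = gwaOf G (gwaT G (i + j - c)) ⊗ₜ[R] (r • x)
  rw [← TensorProduct.smul_tmul, gwa_AR_smul, add_sub_assoc, ← hr, ← map_smul, smul_eq_mul]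

theorem gwa_ind_decomp (c : ℤ) (x : GwaAR G ⊗[R] V) :
    ∃ b : ℤ →₀ V, x = ∑ i ∈ b.support, gwaB V G c i (b i) := by
  obtain ⟨b, hb⟩ := TensorProduct.eq_repr_basis_left (gwaBasis G c) x
  refine ⟨b, ?_⟩
  rw [← hb]
  refine Finset.sum_congr rfl fun i _ => ?_
  show gwaBasis G c i ⊗ₜ[R] b i = gwaOf G (gwaT G (i - c)) ⊗ₜ[R] b i
  rw [gwaBasis_apply]

theorem gwa_ind_indep (c : ℤ) (s : Finset ℤ) (n : ℤ → V) (h : ∑ i ∈ s, gwaB V G c i (n i) = 0)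
    (i : ℤ) (hi : i ∈ s) : n i = 0 := by
  classical
  have h1 := congrArg (fun x => TensorProduct.equivFinsuppOfBasisLeft (N := V) (gwaBasis G c) x i) h
  simp only [map_sum, map_zero] at h1
  have h2 : ∀ j, TensorProduct.equivFinsuppOfBasisLeft (N := V) (gwaBasis G c) (gwaB V G c j (n j)) i
      = if j = i then n j else 0 := by
    intro j
    show TensorProduct.equivFinsuppOfBasisLeft (N := V) (gwaBasis G c)
      (gwaOf G (gwaT G (j - c)) ⊗ₜ[R] n j) i = _
    rw [← gwaBasis_apply, TensorProduct.equivFinsuppOfBasisLeft_apply_tmul_apply,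
      Module.Basis.repr_self, Finsupp.single_apply]
    split_ifs
    · rw [one_smul]
    · rw [zero_smul]
  rw [Finsupp.finsetSum_apply, Finsupp.zero_apply, Finset.sum_congr rfl (fun j _ => h2 j),
    Finset.sum_ite_eq' s i n, if_pos hi] at h1
  exact h1

/-- Induced graded module with generators in degree `c`. -/
@[reducible] def gwaInd (G : GWA R σ v) (c : ℤ) : GradedMod G where
  M := GwaAR G ⊗[R] V
  deg i := (gwaB V G c i).toAddMonoidHom.range
  smul_mem := by
    rintro i j a _ ha ⟨x, rfl⟩
    obtain ⟨y, hy⟩ := gwa_ind_smul_mem V c (j := j) ha x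
    exact ⟨y, hy.symm⟩
  decomp := by
    intro x
    obtain ⟨b, hb⟩ := gwa_ind_decomp V (G := G) c x
    exact ⟨b.support, fun i => gwaB V G c i (b i), fun i => ⟨b i, rfl⟩, hb⟩
  indep := by
    intro s g hg h i hi
    choose n hn using hg
    have hn' : ∀ i, gwaB V G c i (n i) = g i := hn
    rw [Finset.sum_congr rfl (fun j _ => (hn' j).symm)] at h
    rw [← hn' i, gwa_ind_indep V c s n h i hi, map_zero]

variable {V} {W : Type} [AddCommGroup W] [Module R W]

/-- functoriality -/
def gwaIndMap (G : GWA R σ v) (f : V →ₗ[R] W) : GwaAR G ⊗[R] V →ₗ[G.A] GwaAR G ⊗[R] W where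
  toFun x := f.lTensor (GwaAR G) x
  map_add' x y := map_add _ x y
  map_smul' a x := by
    induction x using TensorProduct.induction_on with
    | zero => simp
    | add x y hx hy => rw [smul_add, map_add, map_add, smul_add, hx, hy]
    | tmul b x => simp [TensorProduct.smul_tmul']

theorem gwaIndMap_deg (c : ℤ) (f : V →ₗ[R] W) (i : ℤ) (x : GwaAR G ⊗[R] V)
    (hx : x ∈ (gwaInd V G c).deg i) : gwaIndMap G f x ∈ (gwaInd W G c).deg i := by
  obtain ⟨y, rfl⟩ := hx
  exact ⟨f y, rfl⟩

variable {U : Type} [AddCommGroup U] [Module R U]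

theorem gwaIndMap_exact (f : U →ₗ[R] V) (g : V →ₗ[R] W) (h : Function.Exact f g) :
    Function.Exact (gwaIndMap G f) (gwaIndMap G g) := Module.Flat.lTensor_exact (GwaAR G) h

theorem gwaIndMap_inj (f : V →ₗ[R] W) (h : Function.Injective f) :
    Function.Injective (gwaIndMap G f) := Module.Flat.lTensor_preserves_injective_linearMap f h

theorem gwaIndMap_surj (f : V →ₗ[R] W) (h : Function.Surjective f) :
    Function.Surjective (gwaIndMap G f) := LinearMap.lTensor_surjective (GwaAR G) h

end Ind

instance gwaDegMod (X : GradedMod G) (c : ℤ) : Module R ↥(X.deg c) where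
  smul r x := ⟨G.emb r • x.1, gwa_emb_smul_mem X x.2 r⟩
  one_smul x := Subtype.ext (by show G.emb 1 • x.1 = x.1; rw [map_one, one_smul])
  mul_smul r s x := Subtype.ext (by
    show G.emb (r * s) • x.1 = G.emb r • G.emb s • x.1; rw [map_mul, mul_smul])
  smul_zero r := Subtype.ext (by show G.emb r • (0 : X.M) = 0; rw [smul_zero])
  smul_add r x y := Subtype.ext (by
    show G.emb r • (x.1 + y.1) = G.emb r • x.1 + G.emb r • y.1; rw [smul_add])
  add_smul r s x := Subtype.ext (by
    show G.emb (r + s) • x.1 = G.emb r • x.1 + G.emb s • x.1; rw [map_add, add_smul])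
  zero_smul x := Subtype.ext (by show G.emb 0 • x.1 = 0; rw [map_zero, zero_smul])

theorem gwaDeg_smul (X : GradedMod G) (c : ℤ) (r : R) (x : X.deg c) :
    ((r • x : X.deg c) : X.M) = G.emb r • (x : X.M) := rfl

def gwaDegMap {X Y : GradedMod G} (c : ℤ) (f : GHom X Y 0) : X.deg c →ₗ[R] Y.deg c where
  toFun x := ⟨f.toLin x.1, by have := f.map_deg c x.1 x.2; rwa [add_zero] at this⟩
  map_add' x y := Subtype.ext (map_add f.toLin x.1 y.1)
  map_smul' r x := Subtype.ext (map_smul f.toLin (G.emb r) x.1)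

theorem gwaDegMap_val {X Y : GradedMod G} (c : ℤ) (f : GHom X Y 0) (x : X.deg c) :
    (gwaDegMap c f x : Y.M) = f.toLin x.1 := rfl

theorem gwa_hom_lift {X Y : GradedMod G} (f : GHom X Y 0) (c : ℤ) {y : Y.M} (hy : y ∈ Y.deg c)
    {x : X.M} (hx : f.toLin x = y) : ∃ x' : X.deg c, f.toLin x'.1 = y := by
  refine ⟨⟨X.pr c x, gwa_pr_mem X c x⟩, ?_⟩
  have h3 := gwa_map_pr (X := X) (Y := Y) f.toLin.toAddMonoidHom 0 f.map_deg c x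
  rw [add_zero] at h3
  refine h3.trans ?_
  show Y.pr c (f.toLin x) = y
  rw [hx, gwa_pr_same Y hy]

theorem gwaDegMap_exact {X Y Z : GradedMod G} (c : ℤ) (f : GHom X Y 0) (g : GHom Y Z 0)
    (h : Function.Exact f.toLin g.toLin) : Function.Exact (gwaDegMap c f) (gwaDegMap c g) := by
  intro y
  constructor
  · intro hy
    obtain ⟨x, hx⟩ := (h y.1).1 (congrArg Subtype.val hy)
    obtain ⟨x', hx'⟩ := gwa_hom_lift f c y.2 hx
    exact ⟨x', Subtype.ext hx'⟩
  · rintro ⟨x, rfl⟩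
    exact Subtype.ext ((h _).2 ⟨x.1, rfl⟩)

theorem gwaDegMap_inj {X Y : GradedMod G} (c : ℤ) (f : GHom X Y 0)
    (h : Function.Injective f.toLin) : Function.Injective (gwaDegMap c f) :=
  fun _ _ hxy => Subtype.ext (h (congrArg Subtype.val hxy))

theorem gwaDegMap_surj {X Y : GradedMod G} (c : ℤ) (f : GHom X Y 0)
    (h : Function.Surjective f.toLin) : Function.Surjective (gwaDegMap c f) := by
  intro y
  obtain ⟨x, hx⟩ := h y.1
  obtain ⟨x', hx'⟩ := gwa_hom_lift f c y.2 hx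
  exact ⟨x', Subtype.ext hx'⟩

/-- the bilinear map behind the adjoint map -/
def gwaIndBil {V : Type} [AddCommGroup V] [Module R V] (X : GradedMod G) (c : ℤ)
    (f : V →ₗ[R] X.deg c) : GwaAR G →+ V →+ X.M where
  toFun a :=
    { toFun := fun x => gwaTo G a • (f x : X.M)
      map_zero' := by rw [map_zero, AddSubgroup.coe_zero, smul_zero]
      map_add' := by intro x y; rw [map_add, AddSubgroup.coe_add, smul_add] }
  map_zero' := by
    ext x
    show gwaTo G 0 • (f x : X.M) = 0
    rw [map_zero, zero_smul]
  map_add' := by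
    intro a b
    ext x
    show gwaTo G (a + b) • (f x : X.M) = gwaTo G a • (f x : X.M) + gwaTo G b • (f x : X.M)
    rw [map_add, add_smul]

theorem gwaIndBil_apply {V : Type} [AddCommGroup V] [Module R V] (X : GradedMod G) (c : ℤ)
    (f : V →ₗ[R] X.deg c) (a : GwaAR G) (x : V) :
    gwaIndBil X c f a x = gwaTo G a • (f x : X.M) := rfl

theorem gwaIndBil_bal {V : Type} [AddCommGroup V] [Module R V] (X : GradedMod G) (c : ℤ)
    (f : V →ₗ[R] X.deg c) (r : R) (a : GwaAR G) (x : V) :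
    gwaIndBil X c f (r • a) x = gwaIndBil X c f a (r • x) := by
  show (gwaTo G a * G.emb r) • (f x : X.M) = gwaTo G a • (f (r • x) : X.M)
  rw [map_smul, gwaDeg_smul, mul_smul]

def gwaIndAdd {V : Type} [AddCommGroup V] [Module R V] (X : GradedMod G) (c : ℤ)
    (f : V →ₗ[R] X.deg c) : GwaAR G ⊗[R] V →+ X.M :=
  TensorProduct.liftAddHom (gwaIndBil X c f) (gwaIndBil_bal X c f)

theorem gwaIndAdd_tmul {V : Type} [AddCommGroup V] [Module R V] (X : GradedMod G) (c : ℤ)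
    (f : V →ₗ[R] X.deg c) (a : GwaAR G) (x : V) :
    gwaIndAdd X c f (a ⊗ₜ[R] x) = gwaTo G a • (f x : X.M) := by
  rw [gwaIndAdd, TensorProduct.liftAddHom_tmul, gwaIndBil_apply]

theorem gwaIndAdd_smul {V : Type} [AddCommGroup V] [Module R V] (X : GradedMod G) (c : ℤ)
    (f : V →ₗ[R] X.deg c) (a : G.A) (x : GwaAR G ⊗[R] V) :
    gwaIndAdd X c f (a • x) = a • gwaIndAdd X c f x := by
  induction x using TensorProduct.induction_on with
  | zero => rw [smul_zero, map_zero, smul_zero]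
  | add x y hx hy => rw [smul_add, map_add, map_add, smul_add, hx, hy]
  | tmul b x =>
    rw [TensorProduct.smul_tmul', gwaIndAdd_tmul, gwaIndAdd_tmul, map_smul, smul_eq_mul, mul_smul]

/-- the adjoint map -/
def gwaIndLift {V : Type} [AddCommGroup V] [Module R V] (X : GradedMod G) (c : ℤ)
    (f : V →ₗ[R] X.deg c) : GwaAR G ⊗[R] V →ₗ[G.A] X.M where
  toFun := gwaIndAdd X c f
  map_add' x y := map_add _ x y
  map_smul' a x := gwaIndAdd_smul X c f a x

theorem gwaIndLift_tmul {V : Type} [AddCommGroup V] [Module R V] (X : GradedMod G) (c : ℤ)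
    (f : V →ₗ[R] X.deg c) (a : GwaAR G) (x : V) :
    gwaIndLift X c f (a ⊗ₜ[R] x) = gwaTo G a • (f x : X.M) := gwaIndAdd_tmul X c f a x

theorem gwaIndLift_B {V : Type} [AddCommGroup V] [Module R V] (X : GradedMod G) (c : ℤ)
    (f : V →ₗ[R] X.deg c) (i : ℤ) (x : V) :
    gwaIndLift X c f (gwaB V G c i x) = gwaT G (i - c) • (f x : X.M) :=
  gwaIndLift_tmul X c f _ x

theorem gwaIndLift_deg {V : Type} [AddCommGroup V] [Module R V] (X : GradedMod G) (c : ℤ)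
    (f : V →ₗ[R] X.deg c) (i : ℤ) (x : GwaAR G ⊗[R] V) (hx : x ∈ (gwaInd V G c).deg i) :
    gwaIndLift X c f x ∈ X.deg i := by
  obtain ⟨y, rfl⟩ := hx
  have h : gwaT G (i - c) • (f y : X.M) ∈ X.deg (i - c + c) := X.smul_mem (gwaT_mem _) (f y).2
  rw [sub_add_cancel, ← gwaIndLift_B] at h
  exact h

/-- naturality -/
theorem gwaIndLift_nat {V W : Type} [AddCommGroup V] [Module R V] [AddCommGroup W] [Module R W]
    {X Y : GradedMod G} (c : ℤ) (f : V →ₗ[R] X.deg c) (e : V →ₗ[R] W) (g : W →ₗ[R] Y.deg c)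
    (d : GHom X Y 0) (h : gwaDegMap c d ∘ₗ f = g ∘ₗ e) :
    d.toLin ∘ₗ gwaIndLift X c f = gwaIndLift Y c g ∘ₗ gwaIndMap G e := by
  refine LinearMap.ext fun x => ?_
  induction x using TensorProduct.induction_on with
  | zero => rw [map_zero, map_zero]
  | add x y hx hy => rw [map_add, map_add, hx, hy]
  | tmul b x =>
    show d.toLin (gwaIndLift X c f (b ⊗ₜ[R] x)) = gwaIndLift Y c g (b ⊗ₜ[R] (e x))
    rw [gwaIndLift_tmul, gwaIndLift_tmul, map_smul]
    have := congrArg Subtype.val (LinearMap.congr_fun h x)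
    exact congrArg (fun z : Y.M => gwaTo G b • z) this

theorem gwa_counit_bij (lam : Ideal R) (hl : lam.IsMaximal) (hv : ∀ k : ℤ, (σ ^ k) v ∉ lam) (n : ℤ)
    (M : GradedMod G) (hM : ∀ i, ∀ x ∈ M.deg i, GwaTo M (gwaW σ lam (i + n)) x) (c : ℤ) :
    Function.Bijective (gwaIndLift M c (LinearMap.id : M.deg c →ₗ[R] M.deg c)) := by
  constructor
  · rw [injective_iff_map_eq_zero]
    intro x hx
    obtain ⟨b, rfl⟩ := gwa_ind_decomp _ (G := G) c x
    rw [map_sum] at hx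
    simp only [gwaIndLift_B] at hx
    refine Finset.sum_eq_zero fun i hi => ?_
    have h1 := M.indep _ (fun i => gwaT G (i - c) • (b i : M.M)) (fun i => by
      have := M.smul_mem (gwaT_mem (G := G) (i - c)) (b i).2
      rwa [sub_add_cancel] at this) hx i hi
    have h2 : (b i : M.M) = 0 := gwa_bij_inj lam hl hv n M hM (b i).2 h1
    have h3 : b i = 0 := Subtype.ext h2
    rw [h3, map_zero]
  · intro y
    induction y using gwa_hom_ind with
    | h0 => exact ⟨0, map_zero _⟩
    | hadd x y hx hy =>
      obtain ⟨a, rfl⟩ := hx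
      obtain ⟨b, rfl⟩ := hy
      exact ⟨a + b, map_add _ a b⟩
    | hh i y hy =>
      obtain ⟨x, hx, rfl⟩ := gwa_bij_surj lam hl hv n M hM (i := c) (k := i - c) (y := y)
        (by rwa [sub_add_cancel])
      exact ⟨gwaB _ G c i ⟨x, hx⟩, gwaIndLift_B M c _ i _⟩

end GwaIndSec


noncomputable section GwaPartThree
open TensorProduct

variable {R : Type} [CommRing R] [Algebra ℂ R] {σ : R ≃ₐ[ℂ] R} {v : R} {G : GWA R σ v}

theorem gwa_deg_tors [IsNoetherianRing R] (lam : Ideal R) (hl : lam.IsMaximal) (n : ℤ)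
    (M : GradedMod G) (hM : InCat G lam n M) : GwaTors lam (M.deg (-n)) := by
  intro w
  obtain ⟨k, hk⟩ := gwa_cat_tors lam hl n M hM (-n) w.1 w.2
  rw [neg_add_cancel, gwaW_zero] at hk
  exact ⟨k, fun r hr => Subtype.ext (hk r hr)⟩

theorem gwa_inv_deg {X Y : GradedMod G} (f : X.M →ₗ[G.A] Y.M)
    (hf : ∀ i, ∀ x ∈ X.deg i, f x ∈ Y.deg i) (hb : Function.Bijective f) (i : ℤ) (y : Y.M)
    (hy : y ∈ Y.deg i) : (LinearEquiv.ofBijective f hb).symm y ∈ X.deg i := by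
  obtain ⟨x, hx⟩ := hb.2 y
  obtain ⟨x', hx'⟩ := gwa_hom_lift (X := X) (Y := Y) ⟨f, fun i m hm => by
    rw [add_zero]; exact hf i m hm⟩ i hy hx
  have h : (LinearEquiv.ofBijective f hb).symm y = x'.1 := by
    rw [LinearEquiv.symm_apply_eq]; exact hx'.symm
  rw [h]; exact x'.2

theorem gwa_part3_one [IsNoetherianRing R] (lam : Ideal R) (hl : lam.IsMaximal)
    (hv : ∀ k : ℤ, (σ ^ k) v ∉ lam) (n : ℤ) (M N : GradedMod G) (hM : InCat G lam n M)
    (hev : GwaEV R (M.deg (-n)) (N.deg (-n)) 1) (e : GExt1 M N) : e.Split := by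
  obtain ⟨s, hs⟩ := gwa_ev6 (gwaDegMap (-n) e.f) (gwaDegMap (-n) e.g) (gwaDegMap_inj _ _ e.inj)
    (gwaDegMap_exact _ _ _ e.exact) hev (LinearMap.id) (fun w => gwaDegMap_surj _ _ e.surj w)
  have hb := gwa_counit_bij lam hl hv n M (gwa_cat_tors lam hl n M hM) (-n)
  have hnat := gwaIndLift_nat (X := e.E) (Y := M) (-n) s
    (LinearMap.id : M.deg (-n) →ₗ[R] M.deg (-n)) LinearMap.id e.g hs
  let L : (GwaAR G ⊗[R] M.deg (-n)) ≃ₗ[G.A] M.M := LinearEquiv.ofBijective _ hb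
  refine ⟨⟨gwaIndLift e.E (-n) s ∘ₗ L.symm.toLinearMap, fun i m hm => ?_⟩, ?_⟩
  · rw [add_zero]
    exact gwaIndLift_deg e.E (-n) s i _
      (gwa_inv_deg (X := gwaInd (M.deg (-n)) G (-n)) (Y := M) _
        (fun i x hx => gwaIndLift_deg M (-n) LinearMap.id i x hx) hb i m hm)
  · refine LinearMap.ext fun m => ?_
    have h1 := LinearMap.congr_fun hnat (L.symm m)
    have h2 : gwaIndMap G (LinearMap.id : M.deg (-n) →ₗ[R] M.deg (-n)) (L.symm m) = L.symm m :=
      LinearMap.lTensor_id_apply _ _ _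
    have h3 : gwaIndLift M (-n) LinearMap.id (L.symm m) = m := L.apply_symm_apply m
    refine h1.trans ?_
    show gwaIndLift M (-n) LinearMap.id (gwaIndMap G LinearMap.id (L.symm m)) = m
    rw [h2, h3]

/-- terms of the new chain -/
def gwaChE (N : GradedMod G) (F : ℕ → ModuleCat.{0} R) (c : ℤ) : ℕ → GradedMod G
  | 0 => gwaProd N (gwaInd (F 0) G c)
  | i + 1 => gwaInd (F (i + 1)) G c

def gwaChD0 (N : GradedMod G) (F : ℕ → ModuleCat.{0} R) (e : ∀ i, F i →ₗ[R] F (i + 1)) (c : ℤ) :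
    GHom (gwaProd N (gwaInd (F 0) G c)) (gwaInd (F 1) G c) 0 where
  toLin := gwaIndMap G (e 0) ∘ₗ LinearMap.snd G.A N.M (GwaAR G ⊗[R] F 0)
  map_deg i m hm := by
    rw [add_zero]
    exact gwaIndMap_deg c (e 0) i m.2 hm.2

def gwaChDs (F : ℕ → ModuleCat.{0} R) (e : ∀ i, F i →ₗ[R] F (i + 1)) (c : ℤ) (i : ℕ) :
    GHom (gwaInd (F i) G c) (gwaInd (F (i + 1)) G c) 0 where
  toLin := gwaIndMap G (e i)
  map_deg j m hm := by
    rw [add_zero]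
    exact gwaIndMap_deg c (e i) j m hm

/-- differentials of the new chain -/
def gwaChD (N : GradedMod G) (F : ℕ → ModuleCat.{0} R) (e : ∀ i, F i →ₗ[R] F (i + 1)) (c : ℤ) :
    ∀ i, GHom (gwaChE N F c i) (gwaChE N F c (i + 1)) 0
  | 0 => gwaChD0 N F e c
  | i + 1 => gwaChDs F e c (i + 1)

theorem gwaChD_exact (N : GradedMod G) (F : ℕ → ModuleCat.{0} R) (e : ∀ i, F i →ₗ[R] F (i + 1))
    (c : ℤ) (i : ℕ) {Z : Type} [AddCommGroup Z] [Module G.A Z]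
    (ψ : GwaAR G ⊗[R] F (i + 1) →ₗ[G.A] Z) (h : Function.Exact (gwaIndMap G (e i)) ψ) :
    Function.Exact (gwaChD N F e c i).toLin ψ := by
  cases i with
  | zero =>
    intro y
    rw [h y]
    constructor
    · rintro ⟨x, hx⟩
      exact ⟨((0 : N.M), x), hx⟩
    · rintro ⟨x, hx⟩
      exact ⟨x.2, hx⟩
  | succ i => exact h

def gwaChF (N : GradedMod G) (F : ℕ → ModuleCat.{0} R) (c : ℤ) :
    GHom N (gwaProd N (gwaInd (F 0) G c)) 0 where
  toLin := LinearMap.inl G.A N.M (GwaAR G ⊗[R] F 0)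
  map_deg i m hm := by
    rw [add_zero]
    exact ⟨hm, AddSubgroup.zero_mem _⟩

def gwaChR (N : GradedMod G) (F : ℕ → ModuleCat.{0} R) (c : ℤ) :
    GHom (gwaProd N (gwaInd (F 0) G c)) N 0 where
  toLin := LinearMap.fst G.A N.M (GwaAR G ⊗[R] F 0)
  map_deg i m hm := by
    rw [add_zero]
    exact hm.1

theorem gwaIndLift_comp {V : Type} [AddCommGroup V] [Module R V] (M : GradedMod G) (c : ℤ)
    (h : V →ₗ[R] M.deg c) :
    gwaIndLift M c h = gwaIndLift M c LinearMap.id ∘ₗ gwaIndMap G h := by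
  refine LinearMap.ext fun x => ?_
  induction x using TensorProduct.induction_on with
  | zero => rw [map_zero, map_zero]
  | add x y hx hy => rw [map_add, map_add, hx, hy]
  | tmul b x =>
    show gwaIndLift M c h (b ⊗ₜ[R] x) = gwaIndLift M c LinearMap.id (b ⊗ₜ[R] (h x))
    rw [gwaIndLift_tmul, gwaIndLift_tmul]
    rfl

/-- the new chain -/
def gwaCh (M N : GradedMod G) (p : ℕ) (F : ℕ → ModuleCat.{0} R) (e : ∀ i, F i →ₗ[R] F (i + 1))
    (c : ℤ) (h : F (p + 1) →ₗ[R] M.deg c) (hex : GwaEx (p + 1) F e h)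
    (hinj : Function.Injective (e 0))
    (hb : Function.Bijective (gwaIndLift M c (LinearMap.id : M.deg c →ₗ[R] M.deg c))) :
    GExtChain p M N where
  E := gwaChE N F c
  f := gwaChF N F c
  d := gwaChD N F e c
  g := ⟨gwaIndLift M c h, fun i m hm => by
    rw [add_zero]; exact gwaIndLift_deg M c h i m hm⟩
  inj := LinearMap.inl_injective
  ex0 := by
    intro y
    have hi := gwaIndMap_inj (G := G) (e 0) hinj
    constructor
    · intro hy
      have h1 : gwaIndMap G (e 0) y.2 = 0 := hy
      have h2 : y.2 = (0 : GwaAR G ⊗[R] F 0) := hi (h1.trans (map_zero _).symm)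
      exact ⟨y.1, Prod.ext rfl h2.symm⟩
    · rintro ⟨x, rfl⟩
      exact map_zero (gwaIndMap G (e 0))
  exmid i hi := gwaChD_exact N F e c i _
    (gwaIndMap_exact _ _ (((gwa_ex_iff p F e h).1 hex).1 i hi))
  exlast := by
    refine gwaChD_exact N F e c p (gwaIndLift M c h) ?_
    have h1 := gwaIndMap_exact (G := G) _ _ ((gwa_ex_iff p F e h).1 hex).2.1
    rw [gwaIndLift_comp]
    intro y
    rw [← h1 y]
    show gwaIndLift M c LinearMap.id (gwaIndMap G h y) = 0 ↔ _
    exact map_eq_zero_iff _ hb.1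
  surj := by
    show Function.Surjective (gwaIndLift M c h)
    rw [gwaIndLift_comp]
    exact hb.2.comp (gwaIndMap_surj h ((gwa_ex_iff p F e h).1 hex).2.2)

/-- the comparison morphism -/
def gwaChPhi {N : GradedMod G} {E : ℕ → GradedMod G} (f : GHom N (E 0) 0) (F : ℕ → ModuleCat.{0} R)
    (c : ℤ) (φ : ∀ i, F i →ₗ[R] (E i).deg c) :
    ∀ i, (gwaChE N F c i).M →ₗ[G.A] (E i).M
  | 0 => LinearMap.coprod (M := N.M) (M₂ := GwaAR G ⊗[R] F 0) f.toLin (gwaIndLift (E 0) c (φ 0))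
  | i + 1 => gwaIndLift (E (i + 1)) c (φ (i + 1))

theorem gwa_part3_two [IsNoetherianRing R] (lam : Ideal R) (hl : lam.IsMaximal)
    (hv : ∀ k : ℤ, (σ ^ k) v ∉ lam) (n : ℤ) (M N : GradedMod G) (hM : InCat G lam n M)
    (p : ℕ) (hev : GwaEV R (M.deg (-n)) (N.deg (-n)) (p + 2)) (e : GExtChain p M N) :
    GChainZero e := by
  have hb := gwa_counit_bij lam hl hv n M (gwa_cat_tors lam hl n M hM) (-n)
  obtain ⟨F, d, h, φ, hex, hinj, hg, hφ⟩ := gwa_dom_final p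
    (fun i => ModuleCat.of R ((e.E i).deg (-n))) (fun i => gwaDegMap (-n) (e.d i))
    (gwaDegMap (-n) e.g) (gwaDegMap (-n) e.f) (gwaDegMap_inj _ _ e.inj)
    (gwaDegMap_exact _ _ _ e.ex0)
    ((gwa_ex_iff p _ _ _).2 ⟨fun i hi => gwaDegMap_exact _ _ _ (e.exmid i hi),
      gwaDegMap_exact _ _ _ e.exlast, gwaDegMap_surj _ _ e.surj⟩) hev
  let φ' : ∀ i, F i →ₗ[R] (e.E i).deg (-n) := φ
  refine ⟨gwaCh M N p F d (-n) h hex hinj hb, Quot.sound ?_, gwaChR N F (-n), rfl⟩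
  refine ⟨gwaChPhi e.f F (-n) φ', ?_, ?_, ?_, ?_⟩
  · intro i j m hm
    cases i with
    | zero =>
      have h1 := e.f.map_deg j m.1 hm.1
      rw [add_zero] at h1
      exact AddSubgroup.add_mem _ h1 (gwaIndLift_deg _ (-n) (φ' 0) j m.2 hm.2)
    | succ i => exact gwaIndLift_deg _ (-n) (φ' (i + 1)) j m hm
  · refine LinearMap.ext fun x => ?_
    show e.f.toLin x + gwaIndLift (e.E 0) (-n) (φ' 0) 0 = e.f.toLin x
    rw [map_zero, add_zero]
  · intro i hi
    have hnat := gwaIndLift_nat (X := e.E i) (Y := e.E (i + 1)) (-n) (φ' i) (d i) (φ' (i + 1))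
      (e.d i) (hφ i hi)
    cases i with
    | zero =>
      refine LinearMap.ext fun x => ?_
      have h1 := LinearMap.congr_fun hnat x.2
      have h2 : (e.d 0).toLin (e.f.toLin x.1) = 0 := (e.ex0 _).2 ⟨_, rfl⟩
      show (e.d 0).toLin (e.f.toLin x.1 + gwaIndLift (e.E 0) (-n) (φ' 0) x.2) =
        gwaIndLift (e.E 1) (-n) (φ' 1) (gwaIndMap G (d 0) x.2)
      rw [map_add, h2]
      exact (zero_add _).trans h1
    | succ i => exact hnat
  · have hnat := gwaIndLift_nat (X := e.E (p + 1)) (Y := M) (-n) (φ' (p + 1)) h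
      LinearMap.id e.g hg
    refine LinearMap.ext fun x => ?_
    have h1 := LinearMap.congr_fun hnat x
    refine h1.trans ?_
    show gwaIndLift M (-n) LinearMap.id (gwaIndMap G h x) = gwaIndLift M (-n) h x
    rw [gwaIndLift_comp M (-n) h]
    rfl

end GwaPartThree

/-- (1) `C_{λ,n} = C_{μ,m}` iff `μ = σ^{m-n}(λ)`.
(2) Every Artinian graded module decomposes as a direct sum of graded submodules each of which
lies in some `C_{λ,n}`.
(3) If `λ ∉ Z^σ` and `λ` is a regular point of `Spec R` (the maximal ideal of `R_λ` is
generated by `d` elements where `d` is the Krull dimension of `R_λ`), then the homological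
dimension of `C_{λ,n}` is finite, bounded by `d`: all graded `Ext`s of degree `> d` between
objects of `C_{λ,n}` vanish. -/
theorem stmt10 {R : Type} [CommRing R] [Algebra ℂ R] (hfg : Algebra.FiniteType ℂ R)
    {σ : R ≃ₐ[ℂ] R} {v : R} (G : GWA R σ v) :
    (∀ (lam mu : Ideal R), lam.IsMaximal → mu.IsMaximal → ∀ n m : ℤ,
      ((∀ M : GradedMod G, InCat G lam n M ↔ InCat G mu m M) ↔
        mu = Ideal.map ((σ ^ (m - n) : R ≃ₐ[ℂ] R)).toAlgHom.toRingHom lam)) ∧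
    (∀ M : GradedMod G, IsArtinianGr M →
      ∃ (ι : Type) (N : ι → Submodule G.A M.M) (hgr : ∀ i, IsGradedSub M (N i)),
        (⨆ i, N i) = ⊤ ∧
        (∀ i : ι, Disjoint (N i) (⨆ j, ⨆ _ : j ≠ i, N j)) ∧
        (∀ i : ι, ∃ (lam : Ideal R) (n : ℤ), lam.IsMaximal ∧
          InCat G lam n (SubGM M (N i) (hgr i)))) ∧
    (∀ (lam : Ideal R) (inst : lam.IsPrime), lam.IsMaximal →
      (∀ k : ℤ, (σ ^ k) v ∉ lam) →
      ∀ d : ℕ,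
        ringKrullDim (Localization.AtPrime lam) = (d : WithBot (WithTop ℕ)) →
        (∃ s : Finset (Localization.AtPrime lam), s.card = d ∧
          Ideal.span (s : Set (Localization.AtPrime lam))
            = IsLocalRing.maximalIdeal (Localization.AtPrime lam)) →
      ∀ n : ℤ, ∀ M N : GradedMod G, InCat G lam n M → InCat G lam n N →
        ((1 > d → ∀ e : GExt1 M N, e.Split) ∧
         (∀ p : ℕ, p + 2 > d → ∀ e : GExtChain p M N, GChainZero e))) := by
  have hN : IsNoetherianRing R := Algebra.FiniteType.isNoetherianRing ℂ R
  refine ⟨fun lam mu hl hm n m => gwa_part1 lam mu hl hm n m, fun M hM => gwa_part2 M hM, ?_⟩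
  intro lam inst hl hv d hd hs n M N hM hN
  have hev : ∀ j, d < j → GwaEV R (M.deg (-n)) (N.deg (-n)) j := fun j hj =>
    gwa_ev_main lam hl d hd hs (gwa_deg_tors lam hl n M hM) (gwa_deg_tors lam hl n N hN) j hj
  exact ⟨fun h1 e => gwa_part3_one lam hl hv n M N hM (hev 1 h1) e,
    fun p hp e => gwa_part3_two lam hl hv n M N hM p (hev (p + 2) hp) e⟩
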